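/- arXiv:2411.16663 — 2 statements merged into one kernel-verified Lean document; each statement's English description precedes it below -/
import Mathlib

section
/- Let u : ℝ² → ℂ (with coordinates (t,x)) be C^∞ on ℝ² and satisfy the one-dimensional wave equation ∂²u/∂t² = ∂²u/∂x² at every point (t,x) with 0 ≤ x ≤ π, together with the Dirichlet boundary conditions u(t,0) = 0 and u(t,π) = 0 for all t ∈ ℝ. For j ∈ ℤ define b_j : ℝ² → ℂ by b_j(t,x) = exp(i j t) · sin(j x), where i = √−1. Then for every compact set K ⊆ ℝ × [0,π], every m ∈ ℕ, and every ε > 0, there exist finitely many integers j_1, …, j_r and coefficients c_1, …, c_r ∈ ℂ such that for every k ≤ m, the k-th iterated derivative of u − Σ_{s=1}^r c_s b_{j_s} has norm at most ε at every point of K. -/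
/-- Partial derivative in the first (time) variable. -/
noncomputable def dT (u : ℝ × ℝ → ℂ) : ℝ × ℝ → ℂ :=
  fun p => deriv (fun s => u (s, p.2)) p.1

/-- Partial derivative in the second (space) variable. -/
noncomputable def dX (u : ℝ × ℝ → ℂ) : ℝ × ℝ → ℂ :=
  fun p => deriv (fun s => u (p.1, s)) p.2

/-- B-EPGP basis element for the 1D wave equation on the slab `(0,π)` with Dirichlet
boundary conditions: `b_j(t,x) = e^{i j t} sin(j x)`. -/
noncomputable def slabBasis (j : ℤ) : ℝ × ℝ → ℂ :=
  fun p => Complex.exp (Complex.I * (j : ℂ) * (p.1 : ℂ)) * Complex.sin ((j : ℂ) * (p.2 : ℂ))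

open Set Filter Topology

/-- The exponential `s ↦ e^{i n s}` of integer frequency `n`. -/
noncomputable def expMode (n : ℤ) : ℝ → ℂ := fun s => Complex.exp (Complex.I * n * s)

/-- Trigonometric polynomials with complex coefficients, as functions on the line. -/
noncomputable def trigPoly : Submodule ℂ (ℝ → ℂ) := Submodule.span ℂ (range expMode)

lemma expMode_mem_trigPoly (n : ℤ) : expMode n ∈ trigPoly :=
  Submodule.subset_span ⟨n, rfl⟩

lemma const_mem_trigPoly (c : ℂ) : (fun _ => c) ∈ trigPoly := by
  convert trigPoly.smul_mem c (expMode_mem_trigPoly 0) using 1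
  ext s
  simp [expMode]

lemma contDiff_of_mem_trigPoly {P : ℝ → ℂ} (hP : P ∈ trigPoly) : ContDiff ℝ (⊤ : ℕ∞) P := by
  induction hP using Submodule.span_induction with
  | mem P h =>
    obtain ⟨n, rfl⟩ := h
    exact (contDiff_const.mul Complex.ofRealCLM.contDiff).cexp
  | zero => exact contDiff_const
  | add P Q _ _ hP hQ => exact hP.add hQ
  | smul c P _ hP => exact contDiff_const.smul hP

lemma periodic_of_mem_trigPoly {P : ℝ → ℂ} (hP : P ∈ trigPoly) :
    Function.Periodic P (2 * Real.pi) := by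
  induction hP using Submodule.span_induction with
  | mem P h =>
    obtain ⟨n, rfl⟩ := h
    intro s
    refine Complex.exp_eq_exp_iff_exists_int.2 ⟨n, ?_⟩
    push_cast
    ring
  | zero => intro s; rfl
  | add P Q _ _ hP hQ => exact hP.add hQ
  | smul c P _ hP => exact hP.smul c

/-- A trigonometric polynomial minus its mean has a trigonometric polynomial as primitive. -/
lemma exists_primitive_of_mem_trigPoly {Q : ℝ → ℂ} (hQ : Q ∈ trigPoly) :
    ∃ d : ℂ, ∃ P ∈ trigPoly, ∀ s, HasDerivAt P (Q s - d) s := by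
  induction hQ using Submodule.span_induction with
  | mem Q h =>
    obtain ⟨n, rfl⟩ := h
    rcases eq_or_ne n 0 with rfl | hn
    · refine ⟨1, 0, trigPoly.zero_mem, fun s => ?_⟩
      simp [expMode]
    · refine ⟨0, _, trigPoly.smul_mem (Complex.I * n)⁻¹ (expMode_mem_trigPoly n), fun s => ?_⟩
      have hc : Complex.I * n ≠ 0 := by simp [hn]
      have h1 : HasDerivAt (fun s : ℝ => Complex.I * n * (s : ℂ)) (Complex.I * n) s := by
        simpa using Complex.ofRealCLM.hasDerivAt.const_mul (Complex.I * (n : ℂ))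
      refine (h1.cexp.const_mul (Complex.I * (n : ℂ))⁻¹).congr_deriv ?_
      simp only [expMode]
      field_simp
      simp
  | zero => exact ⟨0, 0, trigPoly.zero_mem, fun s => by simp⟩
  | add Q R _ _ hQ hR =>
    obtain ⟨d, P, hP, hPd⟩ := hQ
    obtain ⟨e, S, hS, hSd⟩ := hR
    refine ⟨d + e, _, trigPoly.add_mem hP hS, fun s => ((hPd s).add (hSd s)).congr_deriv ?_⟩
    simp only [Pi.add_apply]
    ring
  | smul c Q _ hQ =>
    obtain ⟨d, P, hP, hPd⟩ := hQ
    refine ⟨c * d, _, trigPoly.smul_mem c hP, fun s => ((hPd s).const_smul c).congr_deriv ?_⟩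
    simp only [Pi.smul_apply, smul_eq_mul]
    ring

/-- Weierstrass approximation by trigonometric polynomials. -/
lemma exists_trigPoly_near {f : ℝ → ℂ} (hf : Continuous f)
    (hper : Function.Periodic f (2 * Real.pi)) {δ : ℝ} (hδ : 0 < δ) :
    ∃ P ∈ trigPoly, ∀ s, ‖f s - P s‖ ≤ δ := by
  have : Fact (0 < 2 * Real.pi) := ⟨Real.two_pi_pos⟩
  let F : C(AddCircle (2 * Real.pi), ℂ) := ⟨hper.lift, continuous_coinduced_dom.2 hf⟩
  have hF : F ∈ (Submodule.span ℂ (range (@fourier (2 * Real.pi)))).topologicalClosure := by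
    rw [span_fourier_closure_eq_top]
    trivial
  obtain ⟨G, hG, hFG⟩ := Metric.mem_closure_iff.1 hF δ hδ
  refine ⟨fun s => G (s : AddCircle (2 * Real.pi)), ?_, fun s => ?_⟩
  · clear hFG
    induction hG using Submodule.span_induction with
    | mem G h =>
      obtain ⟨n, rfl⟩ := h
      convert expMode_mem_trigPoly n using 1
      ext s
      rw [fourier_coe_apply, expMode]
      congr 1
      push_cast
      have : (Real.pi : ℂ) ≠ 0 := by exact_mod_cast Real.pi_ne_zero
      field_simp
    | zero => exact trigPoly.zero_mem
    | add G H _ _ hG hH => exact trigPoly.add_mem hG hH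
    | smul c G _ hG => exact trigPoly.smul_mem c hG
  · have h := (ContinuousMap.dist_apply_le_dist (f := F) (g := G) (s : AddCircle _)).trans hFG.le
    rwa [dist_eq_norm] at h

/-- A smooth periodic function is approximated by trigonometric polynomials together with its
derivatives up to any fixed order. -/
lemma exists_trigPoly_iteratedDeriv_near (m : ℕ) {f : ℝ → ℂ} (hf : ContDiff ℝ (⊤ : ℕ∞) f)
    (hper : Function.Periodic f (2 * Real.pi)) {δ : ℝ} (hδ : 0 < δ) :
    ∃ P ∈ trigPoly, ∀ k ≤ m, ∀ s, ‖iteratedDeriv k (fun y => f y - P y) s‖ ≤ δ := by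
  induction m generalizing f δ with
  | zero =>
    obtain ⟨P, hP, h⟩ := exists_trigPoly_near hf.continuous hper hδ
    refine ⟨P, hP, fun k hk s => ?_⟩
    obtain rfl : k = 0 := by omega
    simpa using h s
  | succ m ih =>
    have hf' := (contDiff_infty_iff_deriv.1 hf)
    have hper' : Function.Periodic (deriv f) (2 * Real.pi) := fun s => by
      rw [← deriv_comp_add_const, funext hper]
    obtain ⟨Q, hQ, hfQ⟩ := ih hf'.2 hper' (δ := δ / 20) (by positivity)
    obtain ⟨d, P, hP, hPQ⟩ := exists_primitive_of_mem_trigPoly hQ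
    have hQs := contDiff_of_mem_trigPoly hQ
    have hfQ0 : ∀ s, ‖deriv f s - Q s‖ ≤ δ / 20 := fun s => by
      simpa using hfQ 0 (Nat.zero_le _) s
    have hfP : ∀ s, HasDerivAt (fun y => f y - P y) (deriv f s - Q s + d) s := fun s =>
      ((hf'.1 s).hasDerivAt.sub (hPQ s)).congr_deriv (by ring)
    have hpi := Real.pi_pos
    have hd : ‖d‖ ≤ δ / 20 := by
      have h1 : ∀ s, HasDerivAt (fun y : ℝ => f y - P y - d * y) (deriv f s - Q s) s := fun s =>
        ((hfP s).sub (Complex.ofRealCLM.hasDerivAt.const_mul d)).congr_deriv (by simp)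
      have h2 := convex_univ.norm_image_sub_le_of_norm_hasDerivWithin_le
        (fun s _ => (h1 s).hasDerivWithinAt) (fun s _ => hfQ0 s) (mem_univ 0)
        (mem_univ (2 * Real.pi))
      have e1 := hper 0
      have e2 := periodic_of_mem_trigPoly hP 0
      rw [zero_add] at e1 e2
      have e3 : f (2 * Real.pi) - P (2 * Real.pi) - d * ((2 * Real.pi : ℝ) : ℂ)
          - (f 0 - P 0 - d * ((0 : ℝ) : ℂ)) = -(d * ((2 * Real.pi : ℝ) : ℂ)) := by
        rw [e1, e2]; simp
      rw [e3, norm_neg, norm_mul, Complex.norm_real, sub_zero] at h2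
      have h3 : 0 < ‖2 * Real.pi‖ := by simp [Real.pi_ne_zero]
      exact le_of_mul_le_mul_right h2 h3
    set P' : ℝ → ℂ := P + fun _ => f 0 - P 0 with hP'
    have hP'mem : P' ∈ trigPoly := trigPoly.add_mem hP (const_mem_trigPoly _)
    have hfP' : ∀ s, HasDerivAt (fun y => f y - P' y) (deriv f s - Q s + d) s := fun s => by
      have h := (hfP s).sub_const (f 0 - P 0)
      refine h.congr_of_eventuallyEq (Eventually.of_forall fun y => ?_)
      simp only [hP', Pi.add_apply]
      ring
    refine ⟨P', hP'mem, fun k hk s => ?_⟩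
    rcases k with _ | k
    · have hb : ∀ s, ‖deriv f s - Q s + d‖ ≤ δ / 10 := fun s =>
        (norm_add_le _ _).trans (by linarith [hfQ0 s])
      obtain ⟨y, hy, hys⟩ := (hper.sub (periodic_of_mem_trigPoly hP'mem)).exists_mem_Ico₀
        Real.two_pi_pos s
      have h2 := convex_univ.norm_image_sub_le_of_norm_hasDerivWithin_le
        (fun s _ => (hfP' s).hasDerivWithinAt) (fun s _ => hb s) (mem_univ 0) (mem_univ y)
      simp only [Pi.sub_apply] at hys
      rw [iteratedDeriv_zero, hys]
      have h0 : f 0 - P' 0 = 0 := by simp [hP']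
      rw [h0, sub_zero, sub_zero, Real.norm_of_nonneg hy.1] at h2
      have : y ≤ 8 := by linarith [hy.2, Real.pi_le_four]
      nlinarith
    · rw [iteratedDeriv_succ', funext fun y => (hfP' y).deriv]
      have hs : ContDiff ℝ (⊤ : ℕ∞) fun y => deriv f y - Q y := hf'.2.sub hQs
      have hadd : iteratedDeriv k (fun y => deriv f y - Q y + d) s =
          iteratedDeriv k (fun y => deriv f y - Q y) s + iteratedDeriv k (fun _ => d) s :=
        iteratedDeriv_add (hs.contDiffAt.of_le (by exact_mod_cast le_top)) contDiffAt_const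
      rw [hadd, iteratedDeriv_const]
      refine (norm_add_le _ _).trans ?_
      have h1 := hfQ k (by omega) s
      have h2 : ‖if k = 0 then d else 0‖ ≤ δ / 20 := by
        split_ifs
        · exact hd
        · rw [norm_zero]; positivity
      linarith

/-- Functions `P (t + x) - P (t - x)` with `P` a trigonometric polynomial lie in the span of the
slab basis. -/
lemma travelling_mem_span_slabBasis {P : ℝ → ℂ} (hP : P ∈ trigPoly) :
    (fun q : ℝ × ℝ => P (q.1 + q.2) - P (q.1 - q.2)) ∈ Submodule.span ℂ (range slabBasis) := by
  induction hP using Submodule.span_induction with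
  | mem P h =>
    obtain ⟨n, rfl⟩ := h
    convert Submodule.smul_mem _ (2 * Complex.I) (Submodule.subset_span (mem_range_self n)) using 1
    ext q
    simp only [expMode, slabBasis, Pi.smul_apply, smul_eq_mul, Complex.sin]
    have e1 : Complex.exp (Complex.I * n * ((q.1 + q.2 : ℝ) : ℂ)) =
        Complex.exp (Complex.I * n * q.1) * Complex.exp (n * q.2 * Complex.I) := by
      rw [← Complex.exp_add]
      push_cast
      ring_nf
    have e2 : Complex.exp (Complex.I * n * ((q.1 - q.2 : ℝ) : ℂ)) =
        Complex.exp (Complex.I * n * q.1) * Complex.exp (-(n * q.2) * Complex.I) := by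
      rw [← Complex.exp_add]
      push_cast
      ring_nf
    rw [e1, e2]
    linear_combination (Complex.exp (Complex.I * n * q.1) *
      (Complex.exp (n * q.2 * Complex.I) - Complex.exp (-(n * q.2) * Complex.I))) * Complex.I_sq
  | zero =>
    convert Submodule.zero_mem _ using 1
    ext q
    simp
  | add P Q _ _ hP hQ =>
    convert Submodule.add_mem _ hP hQ using 1
    ext q
    simp only [Pi.add_apply]
    ring
  | smul c P _ hP =>
    convert Submodule.smul_mem _ c hP using 1
    ext q
    simp only [Pi.smul_apply, smul_eq_mul]
    ring

lemma dT_eq_fderiv {u : ℝ × ℝ → ℂ} (hu : Differentiable ℝ u) (p : ℝ × ℝ) :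
    dT u p = fderiv ℝ u p (1, 0) :=
  ((hu p).hasFDerivAt.comp_hasDerivAt p.1
    ((hasDerivAt_id p.1).prodMk (hasDerivAt_const p.1 p.2))).deriv

lemma dX_eq_fderiv {u : ℝ × ℝ → ℂ} (hu : Differentiable ℝ u) (p : ℝ × ℝ) :
    dX u p = fderiv ℝ u p (0, 1) :=
  ((hu p).hasFDerivAt.comp_hasDerivAt p.2
    ((hasDerivAt_const p.2 p.1).prodMk (hasDerivAt_id p.2))).deriv

lemma contDiff_dT {u : ℝ × ℝ → ℂ} (hu : ContDiff ℝ (⊤ : ℕ∞) u) : ContDiff ℝ (⊤ : ℕ∞) (dT u) := by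
  rw [funext (dT_eq_fderiv (hu.differentiable (by simp)))]
  exact (hu.fderiv_right (by simp)).clm_apply contDiff_const

lemma contDiff_dX {u : ℝ × ℝ → ℂ} (hu : ContDiff ℝ (⊤ : ℕ∞) u) : ContDiff ℝ (⊤ : ℕ∞) (dX u) := by
  rw [funext (dX_eq_fderiv (hu.differentiable (by simp)))]
  exact (hu.fderiv_right (by simp)).clm_apply contDiff_const

lemma dX_dT_comm {u : ℝ × ℝ → ℂ} (hu : ContDiff ℝ (⊤ : ℕ∞) u) (p : ℝ × ℝ) :
    dX (dT u) p = dT (dX u) p := by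
  have hd : Differentiable ℝ u := hu.differentiable (by simp)
  have hd' : Differentiable ℝ (fderiv ℝ u) :=
    (hu.fderiv_right (m := (⊤ : ℕ∞)) (by simp)).differentiable (by simp)
  rw [dX_eq_fderiv ((contDiff_dT hu).differentiable (by simp)),
    dT_eq_fderiv ((contDiff_dX hu).differentiable (by simp)),
    funext (dT_eq_fderiv hd), funext (dX_eq_fderiv hd),
    fderiv_clm_apply (hd' p) (differentiableAt_const _),
    fderiv_clm_apply (hd' p) (differentiableAt_const _)]
  have hsymm : IsSymmSndFDerivAt ℝ u p :=
    hu.contDiffAt.isSymmSndFDerivAt (by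
      rw [minSmoothness_of_isRCLikeNormedField]
      exact WithTop.coe_le_coe.2 le_top)
  simpa using hsymm (0, 1) (1, 0)

/-- Derivative of a function along a line of slope `c` in the time direction. -/
lemma hasDerivAt_along_line {a : ℝ × ℝ → ℂ} (ha : Differentiable ℝ a) (s c y : ℝ) :
    HasDerivAt (fun y => a (s + c * y, y)) (c * dT a (s + c * y, y) + dX a (s + c * y, y)) y := by
  have hl : HasDerivAt (fun y : ℝ => (s + c * y, y)) (c * 1, 1) y :=
    (((hasDerivAt_id y).const_mul c).const_add s).prodMk (hasDerivAt_id y)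
  have h := (ha (s + c * y, y)).hasFDerivAt.comp_hasDerivAt_of_eq y hl rfl
  refine h.congr_deriv ?_
  rw [dT_eq_fderiv ha, dX_eq_fderiv ha]
  have : ((c * 1, 1) : ℝ × ℝ) = c • (1, 0) + (0, 1) := by simp
  rw [this, map_add, map_smul, Complex.real_smul]

/-- A function with zero derivative on `[0, L]` agrees there with its value at `0`. -/
lemma eq_of_hasDerivAt_zero {φ φ' : ℝ → ℂ} {L : ℝ} (hφ : ∀ y, HasDerivAt φ (φ' y) y)
    (h0 : ∀ y ∈ Icc 0 L, φ' y = 0) {y : ℝ} (hy : y ∈ Icc 0 L) : φ y = φ 0 :=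
  constant_of_has_deriv_right_zero (fun x _ => (hφ x).continuousAt.continuousWithinAt)
    (fun x hx => by simpa [h0 x (Ico_subset_Icc_self hx)] using (hφ x).hasDerivWithinAt) y hy

/-- The spatial derivative of a solution of the wave equation on a slab vanishing on `x = 0` is
determined by its values on `x = 0`. -/
lemma dX_eq_of_wave {u : ℝ × ℝ → ℂ} (hu : ContDiff ℝ (⊤ : ℕ∞) u) {L : ℝ}
    (hwave : ∀ t x : ℝ, 0 ≤ x → x ≤ L → dT (dT u) (t, x) = dX (dX u) (t, x))
    (hbc0 : ∀ t : ℝ, u (t, 0) = 0) (t : ℝ) {x : ℝ} (hx : x ∈ Icc 0 L) :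
    dX u (t, x) = (dX u (t + x, 0) + dX u (t - x, 0)) / 2 := by
  have hT := (contDiff_dT hu).differentiable (by simp)
  have hX := (contDiff_dX hu).differentiable (by simp)
  have hT0 : ∀ t, dT u (t, 0) = 0 := fun t => by simp [dT, hbc0]
  have plus := eq_of_hasDerivAt_zero (L := L)
    (fun y => (hasDerivAt_along_line hX (t + x) (-1) y).add
      (hasDerivAt_along_line hT (t + x) (-1) y))
    (fun y hy => by
      rw [hwave _ _ hy.1 hy.2, dX_dT_comm hu]
      push_cast
      ring) hx
  have minus := eq_of_hasDerivAt_zero (L := L)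
    (fun y => (hasDerivAt_along_line hX (t - x) 1 y).sub
      (hasDerivAt_along_line hT (t - x) 1 y))
    (fun y hy => by
      rw [hwave _ _ hy.1 hy.2, dX_dT_comm hu]
      push_cast
      ring) hx
  simp [hT0] at plus minus
  linear_combination (plus + minus) / 2

/-- Travelling wave representation of smooth solutions of the wave equation on a slab vanishing on
`x = 0`. -/
lemma exists_dAlembert {u : ℝ × ℝ → ℂ} (hu : ContDiff ℝ (⊤ : ℕ∞) u) {L : ℝ}
    (hwave : ∀ t x : ℝ, 0 ≤ x → x ≤ L → dT (dT u) (t, x) = dX (dX u) (t, x))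
    (hbc0 : ∀ t : ℝ, u (t, 0) = 0) :
    ∃ f : ℝ → ℂ, ContDiff ℝ (⊤ : ℕ∞) f ∧
      ∀ t, ∀ x ∈ Icc 0 L, u (t, x) = f (t + x) - f (t - x) := by
  have hg : ContDiff ℝ (⊤ : ℕ∞) fun s : ℝ => dX u (s, 0) / 2 :=
    ((contDiff_dX hu).comp (contDiff_id.prodMk contDiff_const)).div_const 2
  set g : ℝ → ℂ := fun s => dX u (s, 0) / 2 with hgdef
  have hf : ∀ s, HasDerivAt (fun s => ∫ r in (0 : ℝ)..s, g r) (g s) s := fun s =>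
    hg.continuous.integral_hasStrictDerivAt 0 s |>.hasDerivAt
  refine ⟨fun s => ∫ r in (0 : ℝ)..s, g r, ?_, fun t x hx => ?_⟩
  · rw [contDiff_infty_iff_deriv, funext fun s => (hf s).deriv]
    exact ⟨fun s => (hf s).differentiableAt, hg⟩
  · have hline : ∀ y, HasDerivAt (fun y => u (t, y)) (dX u (t, y)) y := fun y => by
      simpa using hasDerivAt_along_line (hu.differentiable (by simp)) t 0 y
    have h := eq_of_hasDerivAt_zero (L := L)
      (fun y => (hline y).sub
        (((hf (t + y)).comp_const_add t y).sub ((hf (t - y)).comp_const_sub t y)))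
      (fun y hy => by
        rw [dX_eq_of_wave hu hwave hbc0 t hy]
        simp only [hgdef]
        ring) hx
    simp only [Pi.sub_apply, hbc0, add_zero, sub_zero, sub_self] at h
    exact sub_eq_zero.1 h

lemma norm_iteratedFDeriv_comp_clm_le {h : ℝ → ℂ} (hh : ContDiff ℝ (⊤ : ℕ∞) h)
    (ℓ : ℝ × ℝ →L[ℝ] ℝ) (k : ℕ) (p : ℝ × ℝ) :
    ‖iteratedFDeriv ℝ k (h ∘ ℓ) p‖ ≤ ‖iteratedDeriv k h (ℓ p)‖ * ‖ℓ‖ ^ k := by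
  rw [ℓ.iteratedFDeriv_comp_right hh p (by exact_mod_cast le_top),
    ← norm_iteratedFDeriv_eq_norm_iteratedDeriv]
  simpa using ContinuousMultilinearMap.norm_compContinuousLinearMap_le
    (iteratedFDeriv ℝ k h (ℓ p)) fun _ => ℓ

/-- Derivative bounds for `h` give derivative bounds for `h (t + x) - h (t - x)`. -/
lemma norm_iteratedFDeriv_travelling_le {h : ℝ → ℂ} (hh : ContDiff ℝ (⊤ : ℕ∞) h) {k : ℕ} {δ : ℝ}
    (hδ : ∀ s, ‖iteratedDeriv k h s‖ ≤ δ) (p : ℝ × ℝ) :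
    ‖iteratedFDeriv ℝ k (fun q : ℝ × ℝ => h (q.1 + q.2) - h (q.1 - q.2)) p‖ ≤ 2 ^ (k + 1) * δ := by
  set ℓ₁ := ContinuousLinearMap.fst ℝ ℝ ℝ + ContinuousLinearMap.snd ℝ ℝ ℝ
  set ℓ₂ := ContinuousLinearMap.fst ℝ ℝ ℝ - ContinuousLinearMap.snd ℝ ℝ ℝ
  have hfst := ContinuousLinearMap.norm_fst_le ℝ ℝ ℝ
  have hsnd := ContinuousLinearMap.norm_snd_le ℝ ℝ ℝ
  have n₁ : ‖ℓ₁‖ ≤ 2 := (norm_add_le _ _).trans (by linarith)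
  have n₂ : ‖ℓ₂‖ ≤ 2 := (norm_sub_le _ _).trans (by linarith)
  have hδ0 : 0 ≤ δ := (norm_nonneg _).trans (hδ 0)
  have key : ∀ ℓ : ℝ × ℝ →L[ℝ] ℝ, ‖ℓ‖ ≤ 2 → ‖iteratedFDeriv ℝ k (h ∘ ℓ) p‖ ≤ δ * 2 ^ k :=
    fun ℓ hℓ => (norm_iteratedFDeriv_comp_clm_le hh ℓ k p).trans (by gcongr; exact hδ _)
  have hk : ((k : ℕ) : WithTop ℕ∞) ≤ ((⊤ : ℕ∞) : WithTop ℕ∞) := by exact_mod_cast le_top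
  have hsub := iteratedFDeriv_sub_apply (i := k) (x := p)
    ((hh.comp ℓ₁.contDiff).contDiffAt.of_le hk) ((hh.comp ℓ₂.contDiff).contDiffAt.of_le hk)
  change ‖iteratedFDeriv ℝ k (h ∘ ℓ₁ - h ∘ ℓ₂) p‖ ≤ _
  rw [hsub]
  refine (norm_sub_le _ _).trans ?_
  rw [pow_succ]
  linarith [key ℓ₁ n₁, key ℓ₂ n₂]

/-- Smooth functions agreeing on a set of unique differentiability have the same iterated
derivatives there. -/
lemma iteratedFDeriv_eq_of_eqOn {v w : ℝ × ℝ → ℂ} (hv : ContDiff ℝ (⊤ : ℕ∞) v)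
    (hw : ContDiff ℝ (⊤ : ℕ∞) w) {S : Set (ℝ × ℝ)} (hS : UniqueDiffOn ℝ S) (hvw : EqOn v w S)
    (k : ℕ) {p : ℝ × ℝ} (hp : p ∈ S) : iteratedFDeriv ℝ k v p = iteratedFDeriv ℝ k w p := by
  have hk : ((k : ℕ) : WithTop ℕ∞) ≤ ((⊤ : ℕ∞) : WithTop ℕ∞) := by exact_mod_cast le_top
  rw [← iteratedFDerivWithin_eq_iteratedFDeriv hS (hv.contDiffAt.of_le hk) hp,
    ← iteratedFDerivWithin_eq_iteratedFDeriv hS (hw.contDiffAt.of_le hk) hp,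
    iteratedFDerivWithin_congr hvw hp]

/-- The family `{e^{i j t} sin(j x)}_{j ∈ ℤ}` has dense span in the smooth solutions of the
1D wave equation on the slab `[0,π]` with Dirichlet boundary conditions at `x = 0` and `x = π`. -/
theorem bepgp_wave1D_slab_dirichlet_dense
    (u : ℝ × ℝ → ℂ) (hu : ContDiff ℝ (⊤ : ℕ∞) u)
    (hwave : ∀ t x : ℝ, 0 ≤ x → x ≤ Real.pi →
      dT (dT u) (t, x) = dX (dX u) (t, x))
    (hbc0 : ∀ t : ℝ, u (t, 0) = 0)
    (hbcπ : ∀ t : ℝ, u (t, Real.pi) = 0)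
    (K : Set (ℝ × ℝ)) (hKc : IsCompact K) (hK : K ⊆ Set.univ ×ˢ Set.Icc 0 Real.pi)
    (m : ℕ) (ε : ℝ) (hε : 0 < ε) :
    ∃ (r : ℕ) (j : Fin r → ℤ) (c : Fin r → ℂ),
      ∀ k ≤ m, ∀ p ∈ K,
        ‖iteratedFDeriv ℝ k (fun q => u q - ∑ s, c s * slabBasis (j s) q) p‖ ≤ ε := by
  have hpi := Real.pi_pos
  obtain ⟨f, hf, hrep⟩ := exists_dAlembert hu hwave hbc0
  have hper : Function.Periodic f (2 * Real.pi) := fun s => by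
    have h := hrep (s + Real.pi) Real.pi ⟨hpi.le, le_rfl⟩
    rw [hbcπ, add_sub_cancel_right, add_assoc, ← two_mul] at h
    exact sub_eq_zero.1 h.symm
  obtain ⟨P, hP, hfP⟩ := exists_trigPoly_iteratedDeriv_near m hf hper
    (δ := ε / 2 ^ (m + 1)) (by positivity)
  have hPs := contDiff_of_mem_trigPoly hP
  obtain ⟨r, c, j, hsum⟩ := Submodule.mem_span_set'.1 (travelling_mem_span_slabBasis hP)
  choose n hn using fun i => (j i).2
  refine ⟨r, n, c, fun k hk p hp => ?_⟩
  have hsum' : ∀ q : ℝ × ℝ, ∑ s, c s * slabBasis (n s) q = P (q.1 + q.2) - P (q.1 - q.2) :=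
    fun q => by simpa [hn] using congrFun hsum q
  simp only [hsum']
  have hsmooth : ∀ g : ℝ → ℂ, ContDiff ℝ (⊤ : ℕ∞) g →
      ContDiff ℝ (⊤ : ℕ∞) fun q : ℝ × ℝ => g (q.1 + q.2) - g (q.1 - q.2) := fun g hg =>
    (hg.comp (contDiff_fst.add contDiff_snd)).sub (hg.comp (contDiff_fst.sub contDiff_snd))
  have hfP' := hf.sub hPs
  rw [iteratedFDeriv_eq_of_eqOn (hu.sub (hsmooth P hPs)) (hsmooth _ hfP')
    (uniqueDiffOn_univ.prod (uniqueDiffOn_Icc hpi)) (fun q hq => ?_) k (hK hp)]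
  · refine (norm_iteratedFDeriv_travelling_le hfP' (hfP k hk) p).trans ?_
    rw [mul_div_assoc', div_le_iff₀ (by positivity), mul_comm]
    gcongr
    norm_num
  · have h := hrep q.1 q.2 hq.2
    simp only [Prod.mk.eta] at h
    rw [h]
    ring
end

section
/- Let u : ℝ³ → ℂ (with coordinates (t,x,y)) be C^∞ on ℝ³ and satisfy the two-dimensional wave equation ∂²u/∂t² = ∂²u/∂x² + ∂²u/∂y² at every point (t,x,y) with 0 ≤ x ≤ π and 0 ≤ y ≤ π, together with the Dirichlet boundary conditions u(t,x,y) = 0 whenever x ∈ {0,π} or y ∈ {0,π}. For j,k ∈ ℤ and s ∈ {1,−1} define b_{j,k,s} : ℝ³ → ℂ by b_{j,k,s}(t,x,y) = exp(s·i·√(j²+k²)·t) · sin(k x) · sin(j y), where i = √−1. Then for every compact set K ⊆ ℝ × [0,π] × [0,π], every m ∈ ℕ, and every ε > 0, there exist finitely many triples (j_h,k_h,s_h) and coefficients c_1, …, c_r ∈ ℂ such that for every ℓ ≤ m, the ℓ-th iterated derivative of u − Σ_{h=1}^r c_h b_{j_h,k_h,s_h} has norm at most ε at every point of K. -/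
/-- Partial derivative in the first variable `t`. -/
noncomputable def d1 (u : ℝ × ℝ × ℝ → ℂ) : ℝ × ℝ × ℝ → ℂ :=
  fun p => deriv (fun s => u (s, p.2.1, p.2.2)) p.1

/-- Partial derivative in the second variable `x`. -/
noncomputable def d2 (u : ℝ × ℝ × ℝ → ℂ) : ℝ × ℝ × ℝ → ℂ :=
  fun p => deriv (fun s => u (p.1, s, p.2.2)) p.2.1

/-- Partial derivative in the third variable `y`. -/
noncomputable def d3 (u : ℝ × ℝ × ℝ → ℂ) : ℝ × ℝ × ℝ → ℂ :=
  fun p => deriv (fun s => u (p.1, p.2.1, s)) p.2.2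

/-- B-EPGP basis element for the 2D wave equation on the square `(0,π)²` with Dirichlet
boundary conditions: `exp(s·i·√(j²+k²)·t) sin(kx) sin(jy)`. -/
noncomputable def squareBasis (j k : ℤ) (s : ℝ) : ℝ × ℝ × ℝ → ℂ :=
  fun p => Complex.exp ((s : ℂ) * Complex.I *
      (Real.sqrt ((j : ℝ) ^ 2 + (k : ℝ) ^ 2) : ℂ) * (p.1 : ℂ)) *
    Complex.sin ((k : ℂ) * (p.2.1 : ℂ)) * Complex.sin ((j : ℂ) * (p.2.2 : ℂ))

/-- The Dirichlet eigenfunction `sin((n+1)x)` of the interval `[0,π]`. -/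
noncomputable def sinMode (n : ℕ) (x : ℝ) : ℂ := Complex.sin (((n : ℂ) + 1) * (x : ℂ))

@[fun_prop]
lemma continuous_sinMode (n : ℕ) : Continuous (sinMode n) := by
  unfold sinMode; fun_prop

lemma sinMode_eq_ofReal (n : ℕ) (x : ℝ) :
    sinMode n x = ((Real.sin (((n : ℝ) + 1) * x) : ℝ) : ℂ) := by
  simp [sinMode]

lemma norm_sinMode_le_one (n : ℕ) (x : ℝ) : ‖sinMode n x‖ ≤ 1 := by
  rw [sinMode_eq_ofReal, Complex.norm_real]
  exact Real.abs_sin_le_one _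

lemma sinMode_zero (n : ℕ) : sinMode n 0 = 0 := by simp [sinMode]

lemma sinMode_pi (n : ℕ) : sinMode n Real.pi = 0 := by
  have := Complex.sin_nat_mul_pi (n + 1)
  push_cast at this
  exact this

lemma integral_cos_int_mul (k : ℤ) :
    ∫ x in (0 : ℝ)..Real.pi, Complex.cos ((k : ℂ) * (x : ℂ)) =
      if k = 0 then (Real.pi : ℂ) else 0 := by
  split_ifs with h
  · simp [h]
  · rw [integral_cos_mul_complex (by exact_mod_cast h)]
    simp [Complex.sin_int_mul_pi]

lemma integral_sinMode_mul_sinMode (m n : ℕ) :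
    ∫ x in (0 : ℝ)..Real.pi, sinMode m x * sinMode n x =
      if m = n then (Real.pi : ℂ) / 2 else 0 := by
  have h : ∀ x : ℝ, sinMode m x * sinMode n x =
      (Complex.cos ((((m : ℤ) - (n : ℤ) : ℤ) : ℂ) * (x : ℂ)) -
        Complex.cos ((((m : ℤ) + (n : ℤ) + 2 : ℤ) : ℂ) * (x : ℂ))) / 2 := by
    intro x
    have h1 : (((m : ℤ) - (n : ℤ) : ℤ) : ℂ) * (x : ℂ) =
        ((m : ℂ) + 1) * x - ((n : ℂ) + 1) * x := by push_cast; ring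
    have h2 : (((m : ℤ) + (n : ℤ) + 2 : ℤ) : ℂ) * (x : ℂ) =
        ((m : ℂ) + 1) * x + ((n : ℂ) + 1) * x := by push_cast; ring
    rw [h1, h2, Complex.cos_sub, Complex.cos_add, sinMode, sinMode]
    ring
  simp_rw [h]
  rw [intervalIntegral.integral_div, intervalIntegral.integral_sub, integral_cos_int_mul,
    integral_cos_int_mul, if_neg (by omega : ¬ ((m : ℤ) + (n : ℤ) + 2 = 0))]
  · by_cases hmn : m = n
    · simp [hmn]
    · rw [if_neg (by omega), if_neg hmn]; simp
  all_goals exact Continuous.intervalIntegrable (by fun_prop) _ _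

lemma integral_mul_sin_int_mul_cos_pow_eq_zero {f : ℝ → ℝ} (hf : Continuous f)
    (h0 : ∀ n : ℕ, ∫ x in (0 : ℝ)..Real.pi, f x * Real.sin (((n : ℝ) + 1) * x) = 0)
    (m : ℕ) (k : ℤ) :
    ∫ x in (0 : ℝ)..Real.pi, f x * (Real.sin ((k : ℝ) * x) * Real.cos x ^ m) = 0 := by
  induction m generalizing k with
  | zero =>
    simp only [pow_zero, mul_one]
    rcases lt_trichotomy k 0 with hk | rfl | hk
    · obtain ⟨n, rfl⟩ : ∃ n : ℕ, k = -((n : ℤ) + 1) := ⟨(-k - 1).toNat, by omega⟩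
      have h : ∀ x : ℝ, f x * Real.sin (((-((n : ℤ) + 1) : ℤ) : ℝ) * x) =
          -(f x * Real.sin (((n : ℝ) + 1) * x)) := by
        intro x
        push_cast
        rw [neg_mul, Real.sin_neg]
        ring
      simp_rw [h]
      rw [intervalIntegral.integral_neg, h0, neg_zero]
    · simp
    · obtain ⟨n, rfl⟩ : ∃ n : ℕ, k = (n : ℤ) + 1 := ⟨(k - 1).toNat, by omega⟩
      push_cast
      exact h0 n
  | succ m ih =>
    have h : ∀ x : ℝ, f x * (Real.sin ((k : ℝ) * x) * Real.cos x ^ (m + 1)) =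
        (f x * (Real.sin (((k + 1 : ℤ) : ℝ) * x) * Real.cos x ^ m) +
          f x * (Real.sin (((k - 1 : ℤ) : ℝ) * x) * Real.cos x ^ m)) / 2 := by
      intro x
      have h1 : ((k + 1 : ℤ) : ℝ) * x = k * x + x := by push_cast; ring
      have h2 : ((k - 1 : ℤ) : ℝ) * x = k * x - x := by push_cast; ring
      rw [h1, h2, Real.sin_add, Real.sin_sub]
      ring
    simp_rw [h]
    rw [intervalIntegral.integral_div, intervalIntegral.integral_add, ih, ih]
    · simp
    all_goals exact Continuous.intervalIntegrable (by fun_prop) _ _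

lemma integral_mul_sin_mul_polynomial_cos_eq_zero {f : ℝ → ℝ} (hf : Continuous f)
    (h0 : ∀ n : ℕ, ∫ x in (0 : ℝ)..Real.pi, f x * Real.sin (((n : ℝ) + 1) * x) = 0)
    (p : Polynomial ℝ) :
    ∫ x in (0 : ℝ)..Real.pi, f x * (Real.sin x * p.eval (Real.cos x)) = 0 := by
  induction p using Polynomial.induction_on' with
  | add p q hp hq =>
    simp only [Polynomial.eval_add, mul_add]
    rw [intervalIntegral.integral_add, hp, hq, add_zero]
    all_goals exact (hf.mul (Real.continuous_sin.mul
      ((Polynomial.continuous _).comp Real.continuous_cos))).intervalIntegrable _ _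
  | monomial n a =>
    have h := integral_mul_sin_int_mul_cos_pow_eq_zero hf h0 n 1
    have h' : ∀ x : ℝ, f x * (Real.sin x * (Polynomial.monomial n a).eval (Real.cos x)) =
        a * (f x * (Real.sin (((1 : ℤ) : ℝ) * x) * Real.cos x ^ n)) := by
      intro x
      simp only [Polynomial.eval_monomial, Int.cast_one, one_mul]
      ring
    simp_rw [h']
    rw [intervalIntegral.integral_const_mul, h, mul_zero]

lemma eq_zero_of_integral_mul_sin_eq_zero {f : ℝ → ℝ} (hf : Continuous f)
    (h0 : ∀ n : ℕ, ∫ x in (0 : ℝ)..Real.pi, f x * Real.sin (((n : ℝ) + 1) * x) = 0)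
    {x : ℝ} (hx : x ∈ Set.Icc 0 Real.pi) : f x = 0 := by
  have hsq : ∫ x in (0 : ℝ)..Real.pi, f x ^ 2 * Real.sin x = 0 := by
    obtain ⟨M, hM⟩ := (isCompact_Icc (a := (0 : ℝ)) (b := Real.pi)).exists_bound_of_continuousOn
      hf.continuousOn
    have hM0 : 0 ≤ M := (norm_nonneg _).trans (hM 0 ⟨le_rfl, Real.pi_pos.le⟩)
    refine norm_le_zero_iff.mp (le_of_forall_pos_le_add fun ε hε => ?_)
    set δ := ε / ((M + 1) * Real.pi) with hδ
    have hδ0 : 0 < δ := by have := Real.pi_pos; positivity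
    obtain ⟨p, hp⟩ := exists_polynomial_near_of_continuousOn (-1) 1 (fun y => f (Real.arccos y))
      (hf.comp Real.continuous_arccos).continuousOn δ hδ0
    have hsub : ∫ x in (0 : ℝ)..Real.pi, f x ^ 2 * Real.sin x =
        ∫ x in (0 : ℝ)..Real.pi, f x * Real.sin x * (f x - p.eval (Real.cos x)) := by
      have hp0 := integral_mul_sin_mul_polynomial_cos_eq_zero hf h0 p
      refine (sub_eq_self.mpr hp0).symm.trans ?_
      rw [← intervalIntegral.integral_sub]
      · congr 1 with x
        ring
      · exact Continuous.intervalIntegrable (by fun_prop) _ _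
      · exact (hf.mul (Real.continuous_sin.mul
          (p.continuous.comp Real.continuous_cos))).intervalIntegrable _ _
    rw [hsub]
    refine (intervalIntegral.norm_integral_le_of_norm_le_const (C := (M + 1) * δ) ?_).trans ?_
    · intro x hx
      rw [Set.uIoc_of_le Real.pi_pos.le] at hx
      have hx' : x ∈ Set.Icc 0 Real.pi := ⟨hx.1.le, hx.2⟩
      have h1 := hp (Real.cos x) ⟨Real.neg_one_le_cos x, Real.cos_le_one x⟩
      rw [Real.arccos_cos hx'.1 hx'.2, abs_sub_comm] at h1
      rw [norm_mul, norm_mul]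
      have h2 : ‖f x‖ * ‖Real.sin x‖ ≤ (M + 1) * 1 :=
        mul_le_mul ((hM x hx').trans (by linarith)) (Real.abs_sin_le_one x) (norm_nonneg _)
          (by linarith)
      rw [mul_one] at h2
      exact mul_le_mul h2 h1.le (norm_nonneg _) (by linarith)
    · rw [sub_zero, abs_of_pos Real.pi_pos, hδ, zero_add]
      have := Real.pi_pos
      apply le_of_eq
      field_simp
  have hIoo : ∀ y ∈ Set.Ioo 0 Real.pi, f y = 0 := by
    intro y hy
    by_contra hne
    have hpos := intervalIntegral.integral_pos (f := fun x => f x ^ 2 * Real.sin x) Real.pi_pos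
      (by fun_prop)
      (fun z hz => mul_nonneg (sq_nonneg _) (Real.sin_nonneg_of_nonneg_of_le_pi hz.1.le hz.2))
      ⟨y, ⟨hy.1.le, hy.2.le⟩, mul_pos (by positivity) (Real.sin_pos_of_mem_Ioo hy)⟩
    exact hpos.ne' hsq
  have hcl : x ∈ closure (Set.Ioo 0 Real.pi) := by rwa [closure_Ioo Real.pi_pos.ne]
  exact Set.EqOn.closure (s := Set.Ioo 0 Real.pi) (g := fun _ => (0 : ℝ)) hIoo hf
    continuous_const hcl

lemma eq_zero_of_integral_mul_sinMode_eq_zero {g : ℝ → ℂ} (hg : Continuous g)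
    (h0 : ∀ n : ℕ, ∫ x in (0 : ℝ)..Real.pi, g x * sinMode n x = 0)
    {x : ℝ} (hx : x ∈ Set.Icc 0 Real.pi) : g x = 0 := by
  have hint : ∀ n : ℕ, IntervalIntegrable (fun x => g x * sinMode n x) MeasureTheory.volume
      0 Real.pi := fun n => Continuous.intervalIntegrable (by fun_prop) _ _
  apply Complex.ext
  · refine eq_zero_of_integral_mul_sin_eq_zero (Complex.continuous_re.comp hg) (fun n => ?_) hx
    have h := Complex.reCLM.intervalIntegral_comp_comm (hint n)
    rw [h0 n, map_zero] at h
    rw [← h]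
    congr 1 with y
    rw [sinMode_eq_ofReal, Complex.reCLM_apply, Complex.re_mul_ofReal]
    rfl
  · refine eq_zero_of_integral_mul_sin_eq_zero (Complex.continuous_im.comp hg) (fun n => ?_) hx
    have h := Complex.imCLM.intervalIntegral_comp_comm (hint n)
    rw [h0 n, map_zero] at h
    rw [← h]
    congr 1 with y
    rw [sinMode_eq_ofReal, Complex.imCLM_apply, Complex.im_mul_ofReal]
    rfl

/-- The double sine coefficient (without normalization) of a function on `[0,π]²`. -/
noncomputable def sineCoeff (g : ℝ → ℝ → ℂ) (i : ℕ × ℕ) : ℂ :=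
  ∫ y in (0 : ℝ)..Real.pi, (∫ x in (0 : ℝ)..Real.pi, g x y * sinMode i.1 x) * sinMode i.2 y

lemma continuous_integral_mul_sinMode {g : ℝ → ℝ → ℂ} (hg : Continuous (Function.uncurry g))
    (n : ℕ) : Continuous fun y => ∫ x in (0 : ℝ)..Real.pi, g x y * sinMode n x := by
  apply intervalIntegral.continuous_parametric_intervalIntegral_of_continuous' (a₀ := 0)
  exact (hg.comp (by fun_prop : Continuous fun q : ℝ × ℝ => (q.2, q.1))).mul (by fun_prop)

lemma eq_zero_of_sineCoeff_eq_zero {g : ℝ → ℝ → ℂ} (hg : Continuous (Function.uncurry g))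
    (h0 : ∀ i, sineCoeff g i = 0) {x y : ℝ} (hx : x ∈ Set.Icc 0 Real.pi)
    (hy : y ∈ Set.Icc 0 Real.pi) : g x y = 0 := by
  refine eq_zero_of_integral_mul_sinMode_eq_zero (g := fun x => g x y)
    (hg.comp (by fun_prop : Continuous fun x : ℝ => (x, y))) (fun m => ?_) hx
  exact eq_zero_of_integral_mul_sinMode_eq_zero (continuous_integral_mul_sinMode hg m)
    (fun n => h0 (m, n)) hy

lemma sineCoeff_sub {g h : ℝ → ℝ → ℂ} (hg : Continuous (Function.uncurry g))
    (hh : Continuous (Function.uncurry h)) (i : ℕ × ℕ) :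
    sineCoeff (fun x y => g x y - h x y) i = sineCoeff g i - sineCoeff h i := by
  have hsec : ∀ {g : ℝ → ℝ → ℂ}, Continuous (Function.uncurry g) → ∀ y,
      Continuous fun x => g x y := fun hg y =>
    hg.comp (by fun_prop : Continuous fun x : ℝ => (x, y))
  unfold sineCoeff
  rw [← intervalIntegral.integral_sub]
  · congr 1 with y
    rw [← sub_mul, ← intervalIntegral.integral_sub]
    · simp only [sub_mul]
    · exact ((hsec hg y).mul (continuous_sinMode _)).intervalIntegrable _ _
    · exact ((hsec hh y).mul (continuous_sinMode _)).intervalIntegrable _ _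
  · exact ((continuous_integral_mul_sinMode hg _).mul (continuous_sinMode _)).intervalIntegrable _ _
  · exact ((continuous_integral_mul_sinMode hh _).mul (continuous_sinMode _)).intervalIntegrable _ _

lemma norm_sineCoeff_le {g : ℝ → ℝ → ℂ} {C : ℝ} (hC : 0 ≤ C)
    (hg : ∀ x ∈ Set.Icc 0 Real.pi, ∀ y ∈ Set.Icc 0 Real.pi, ‖g x y‖ ≤ C) (i : ℕ × ℕ) :
    ‖sineCoeff g i‖ ≤ C * Real.pi * Real.pi := by
  have hpi := Real.pi_pos
  have key : ∀ (h : ℝ → ℂ) (n : ℕ) (D : ℝ), 0 ≤ D → (∀ x ∈ Set.Icc 0 Real.pi, ‖h x‖ ≤ D) →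
      ‖∫ x in (0 : ℝ)..Real.pi, h x * sinMode n x‖ ≤ D * Real.pi := by
    intro h n D hD hh
    refine (intervalIntegral.norm_integral_le_of_norm_le_const (C := D) fun x hx => ?_).trans ?_
    · rw [Set.uIoc_of_le hpi.le] at hx
      rw [norm_mul]
      exact (mul_le_mul (hh x ⟨hx.1.le, hx.2⟩) (norm_sinMode_le_one n x) (norm_nonneg _)
        hD).trans_eq (mul_one D)
    · rw [sub_zero, abs_of_pos hpi]
  exact key _ _ _ (by positivity) fun y hy => key _ _ _ hC fun x hx => hg x hx y hy

lemma sineCoeff_product (a : ℂ) (i i' : ℕ × ℕ) :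
    sineCoeff (fun x y => a * sinMode i.1 x * sinMode i.2 y) i' =
      if i = i' then a * ((Real.pi : ℂ) / 2) ^ 2 else 0 := by
  have h : ∀ y, (∫ x in (0 : ℝ)..Real.pi, a * sinMode i.1 x * sinMode i.2 y * sinMode i'.1 x) *
      sinMode i'.2 y = (a * if i.1 = i'.1 then (Real.pi : ℂ) / 2 else 0) *
        (sinMode i.2 y * sinMode i'.2 y) := by
    intro y
    rw [← integral_sinMode_mul_sinMode]
    have h' : ∀ x, a * sinMode i.1 x * sinMode i.2 y * sinMode i'.1 x =
        (a * sinMode i.2 y) * (sinMode i.1 x * sinMode i'.1 x) := fun x => by ring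
    simp_rw [h']
    rw [intervalIntegral.integral_const_mul]
    ring
  unfold sineCoeff
  simp_rw [h]
  rw [intervalIntegral.integral_const_mul, integral_sinMode_mul_sinMode]
  by_cases h1 : i.1 = i'.1 <;> by_cases h2 : i.2 = i'.2 <;> simp [h1, h2, Prod.ext_iff]; ring

lemma sineCoeff_sum (s : Finset (ℕ × ℕ)) (a : ℕ × ℕ → ℂ) (i' : ℕ × ℕ) :
    sineCoeff (fun x y => ∑ i ∈ s, a i * sinMode i.1 x * sinMode i.2 y) i' =
      if i' ∈ s then a i' * ((Real.pi : ℂ) / 2) ^ 2 else 0 := by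
  induction s using Finset.cons_induction with
  | empty => simp [sineCoeff]
  | cons j s hj ih =>
    have h : ∀ x y, ∑ i ∈ Finset.cons j s hj, a i * sinMode i.1 x * sinMode i.2 y =
        ∑ i ∈ s, a i * sinMode i.1 x * sinMode i.2 y -
          (-a j) * sinMode j.1 x * sinMode j.2 y := by
      intro x y
      rw [Finset.sum_cons]
      ring
    simp_rw [h]
    rw [sineCoeff_sub, ih, sineCoeff_product]
    · by_cases h1 : j = i'
      · subst h1
        simp [hj]
      · simp [h1, Ne.symm h1]
    all_goals
      simp only [Function.uncurry_def]
      fun_prop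

/-- A continuous function on `[0,π]²` is the sum of its double sine series as soon as the series
converges absolutely. -/
lemma eq_tsum_of_sineCoeff {g : ℝ → ℝ → ℂ} (hg : Continuous (Function.uncurry g))
    {a : ℕ × ℕ → ℂ} (ha : Summable fun i => ‖a i‖)
    (hcoeff : ∀ i, sineCoeff g i = a i * ((Real.pi : ℂ) / 2) ^ 2)
    {x y : ℝ} (hx : x ∈ Set.Icc 0 Real.pi) (hy : y ∈ Set.Icc 0 Real.pi) :
    g x y = ∑' i : ℕ × ℕ, a i * sinMode i.1 x * sinMode i.2 y := by
  set F : ℕ × ℕ → ℝ × ℝ → ℂ := fun i q => a i * sinMode i.1 q.1 * sinMode i.2 q.2 with hF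
  have hFc : ∀ i, Continuous (F i) := fun i => by rw [hF]; fun_prop
  have hFb : ∀ i q, ‖F i q‖ ≤ ‖a i‖ := by
    intro i q
    simp only [hF, norm_mul]
    have h1 := norm_sinMode_le_one i.1 q.1
    have h2 := norm_sinMode_le_one i.2 q.2
    calc ‖a i‖ * ‖sinMode i.1 q.1‖ * ‖sinMode i.2 q.2‖ ≤ ‖a i‖ * 1 * 1 := by gcongr
      _ = ‖a i‖ := by ring
  have hvc : Continuous (Function.uncurry fun x y => ∑' i, F i (x, y)) :=
    continuous_tsum hFc ha hFb
  have hunif := tendstoUniformly_tsum ha hFb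
  refine sub_eq_zero.mp (eq_zero_of_sineCoeff_eq_zero
    (g := fun x y => g x y - ∑' i, F i (x, y)) (hg.sub hvc) (fun i' => ?_) hx hy)
  rw [sineCoeff_sub hg hvc]
  refine norm_le_zero_iff.mp (le_of_forall_pos_le_add fun ε hε => ?_)
  have hpi := Real.pi_pos
  have hδ : 0 < ε / (Real.pi * Real.pi) := by positivity
  obtain ⟨s, hs, hi'⟩ := ((Metric.tendstoUniformly_iff.mp hunif _ hδ).and
    (Filter.eventually_ge_atTop {i'})).exists
  have hsc : Continuous (Function.uncurry fun x y => ∑ i ∈ s, F i (x, y)) := by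
    simp only [Function.uncurry_def]
    fun_prop
  have h1 : sineCoeff g i' = sineCoeff (fun x y => ∑ i ∈ s, F i (x, y)) i' := by
    rw [hcoeff, sineCoeff_sum, if_pos (hi' (Finset.mem_singleton_self i'))]
  rw [h1, ← sineCoeff_sub hsc hvc]
  refine (norm_sineCoeff_le hδ.le (fun x _ y _ => ?_) i').trans_eq ?_
  · rw [← dist_eq_norm, dist_comm]
    exact (hs (x, y)).le
  · field_simp
    ring
lemma hasDerivAt_fderiv_apply_fst {u : ℝ × ℝ × ℝ → ℂ} (hu : ContDiff ℝ (⊤ : ℕ∞) u) (p : ℝ × ℝ × ℝ) :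
    HasDerivAt (fun s => u (s, p.2.1, p.2.2)) (fderiv ℝ u p (1, 0, 0)) p.1 :=
  ((hu.differentiable (by simp)) p).hasFDerivAt.comp_hasDerivAt (f := fun s => (s, p.2.1, p.2.2))
    p.1 ((hasDerivAt_id _).prodMk ((hasDerivAt_const _ _).prodMk (hasDerivAt_const _ _)))

lemma hasDerivAt_fderiv_apply_mid {u : ℝ × ℝ × ℝ → ℂ} (hu : ContDiff ℝ (⊤ : ℕ∞) u) (p : ℝ × ℝ × ℝ) :
    HasDerivAt (fun s => u (p.1, s, p.2.2)) (fderiv ℝ u p (0, 1, 0)) p.2.1 :=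
  ((hu.differentiable (by simp)) p).hasFDerivAt.comp_hasDerivAt (f := fun s => (p.1, s, p.2.2))
    p.2.1 ((hasDerivAt_const _ _).prodMk ((hasDerivAt_id _).prodMk (hasDerivAt_const _ _)))

lemma hasDerivAt_fderiv_apply_last {u : ℝ × ℝ × ℝ → ℂ} (hu : ContDiff ℝ (⊤ : ℕ∞) u) (p : ℝ × ℝ × ℝ) :
    HasDerivAt (fun s => u (p.1, p.2.1, s)) (fderiv ℝ u p (0, 0, 1)) p.2.2 :=
  ((hu.differentiable (by simp)) p).hasFDerivAt.comp_hasDerivAt (f := fun s => (p.1, p.2.1, s))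
    p.2.2 ((hasDerivAt_const _ _).prodMk ((hasDerivAt_const _ _).prodMk (hasDerivAt_id _)))

lemma contDiff_fderiv_apply {u : ℝ × ℝ × ℝ → ℂ} (hu : ContDiff ℝ (⊤ : ℕ∞) u) (v : ℝ × ℝ × ℝ) :
    ContDiff ℝ (⊤ : ℕ∞) fun p => fderiv ℝ u p v :=
  (hu.fderiv_right (m := (⊤ : ℕ∞)) (by simp)).clm_apply contDiff_const

lemma hasDerivAt_d1 {u : ℝ × ℝ × ℝ → ℂ} (hu : ContDiff ℝ (⊤ : ℕ∞) u) (t x y : ℝ) :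
    HasDerivAt (fun s => u (s, x, y)) (d1 u (t, x, y)) t :=
  (hasDerivAt_fderiv_apply_fst hu (t, x, y)).differentiableAt.hasDerivAt

lemma hasDerivAt_d2 {u : ℝ × ℝ × ℝ → ℂ} (hu : ContDiff ℝ (⊤ : ℕ∞) u) (t x y : ℝ) :
    HasDerivAt (fun s => u (t, s, y)) (d2 u (t, x, y)) x :=
  (hasDerivAt_fderiv_apply_mid hu (t, x, y)).differentiableAt.hasDerivAt

lemma hasDerivAt_d3 {u : ℝ × ℝ × ℝ → ℂ} (hu : ContDiff ℝ (⊤ : ℕ∞) u) (t x y : ℝ) :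
    HasDerivAt (fun s => u (t, x, s)) (d3 u (t, x, y)) y :=
  (hasDerivAt_fderiv_apply_last hu (t, x, y)).differentiableAt.hasDerivAt

lemma contDiff_d1 {u : ℝ × ℝ × ℝ → ℂ} (hu : ContDiff ℝ (⊤ : ℕ∞) u) :
    ContDiff ℝ (⊤ : ℕ∞) (d1 u) :=
  (funext fun p => (hasDerivAt_fderiv_apply_fst hu p).deriv : d1 u = fun p => fderiv ℝ u p (1, 0, 0)) ▸
    contDiff_fderiv_apply hu _

lemma contDiff_d2 {u : ℝ × ℝ × ℝ → ℂ} (hu : ContDiff ℝ (⊤ : ℕ∞) u) :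
    ContDiff ℝ (⊤ : ℕ∞) (d2 u) :=
  (funext fun p => (hasDerivAt_fderiv_apply_mid hu p).deriv : d2 u = fun p => fderiv ℝ u p (0, 1, 0)) ▸
    contDiff_fderiv_apply hu _

lemma contDiff_d3 {u : ℝ × ℝ × ℝ → ℂ} (hu : ContDiff ℝ (⊤ : ℕ∞) u) :
    ContDiff ℝ (⊤ : ℕ∞) (d3 u) :=
  (funext fun p => (hasDerivAt_fderiv_apply_last hu p).deriv : d3 u = fun p => fderiv ℝ u p (0, 0, 1)) ▸
    contDiff_fderiv_apply hu _

lemma contDiff_iterate_d1 {u : ℝ × ℝ × ℝ → ℂ} (hu : ContDiff ℝ (⊤ : ℕ∞) u) (n : ℕ) :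
    ContDiff ℝ (⊤ : ℕ∞) (d1^[n] u) := by
  induction n with
  | zero => exact hu
  | succ n ih =>
    rw [Function.iterate_succ_apply']
    exact contDiff_d1 ih

lemma hasDerivAt_intervalIntegral_of_continuous {F F' : ℝ → ℝ → ℂ}
    (hF : Continuous (Function.uncurry F)) (hF' : Continuous (Function.uncurry F'))
    (h : ∀ t x, HasDerivAt (fun s => F s x) (F' t x) t) (a b t : ℝ) :
    HasDerivAt (fun s => ∫ x in a..b, F s x) (∫ x in a..b, F' t x) t := by
  have hsec : ∀ {G : ℝ → ℝ → ℂ}, Continuous (Function.uncurry G) → ∀ s, Continuous (G s) :=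
    fun hG s => hG.comp (by fun_prop : Continuous fun x : ℝ => (s, x))
  obtain ⟨C, hC⟩ := ((isCompact_Icc (a := t - 1) (b := t + 1)).prod
    (isCompact_uIcc (a := a) (b := b))).exists_bound_of_continuousOn hF'.continuousOn
  refine (intervalIntegral.hasDerivAt_integral_of_dominated_loc_of_deriv_le
    (bound := fun _ => C) (Icc_mem_nhds (by linarith : t - 1 < t) (by linarith : t < t + 1))
    (Filter.Eventually.of_forall fun s => (hsec hF s).aestronglyMeasurable)
    ((hsec hF t).intervalIntegrable _ _) (hsec hF' t).aestronglyMeasurable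
    (Filter.Eventually.of_forall fun x hx s hs => hC (s, x) ⟨hs, Set.uIoc_subset_uIcc hx⟩)
    (by simp) (Filter.Eventually.of_forall fun x _ s _ => h s x)).2

lemma continuous_slice {u : ℝ × ℝ × ℝ → ℂ} (hu : Continuous u) (t : ℝ) :
    Continuous (Function.uncurry fun x y => u (t, x, y)) :=
  hu.comp (by fun_prop : Continuous fun q : ℝ × ℝ => (t, q.1, q.2))

lemma hasDerivAt_sineCoeff {u : ℝ × ℝ × ℝ → ℂ} (hu : ContDiff ℝ (⊤ : ℕ∞) u) (i : ℕ × ℕ) (t : ℝ) :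
    HasDerivAt (fun s => sineCoeff (fun x y => u (s, x, y)) i)
      (sineCoeff (fun x y => d1 u (t, x, y)) i) t := by
  have hcont : ∀ {v : ℝ × ℝ × ℝ → ℂ}, Continuous v → Continuous (Function.uncurry fun s y =>
      (∫ x in (0 : ℝ)..Real.pi, v (s, x, y) * sinMode i.1 x) * sinMode i.2 y) := by
    intro v hv
    refine Continuous.mul ?_ (by fun_prop)
    apply intervalIntegral.continuous_parametric_intervalIntegral_of_continuous' (a₀ := 0)
      (f := fun (q : ℝ × ℝ) x => v (q.1, x, q.2) * sinMode i.1 x)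
    simp only [Function.uncurry_def]
    fun_prop
  refine hasDerivAt_intervalIntegral_of_continuous (hcont hu.continuous)
    (hcont (contDiff_d1 hu).continuous) (fun s y => ?_) _ _ t
  refine (hasDerivAt_intervalIntegral_of_continuous (F := fun s x => u (s, x, y) * sinMode i.1 x)
    (F' := fun s x => d1 u (s, x, y) * sinMode i.1 x) ?_ ?_
    (fun s x => (hasDerivAt_d1 hu s x y).mul_const _) _ _ s).mul_const _
  · have := hu.continuous
    simp only [Function.uncurry_def]
    fun_prop
  · have := (contDiff_d1 hu).continuous
    simp only [Function.uncurry_def]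
    fun_prop

lemma hasDerivAt_sinMode (n : ℕ) (x : ℝ) :
    HasDerivAt (sinMode n) (((n : ℂ) + 1) * Complex.cos (((n : ℂ) + 1) * x)) x := by
  have h := ((Complex.hasDerivAt_sin _).comp (x : ℂ)
    ((hasDerivAt_id (x : ℂ)).const_mul ((n : ℂ) + 1))).comp_ofReal
  refine h.congr_deriv ?_
  simp [mul_comm]

lemma integral_deriv_deriv_mul_sinMode {f f' f'' : ℝ → ℂ} (h1 : ∀ x, HasDerivAt f (f' x) x)
    (h2 : ∀ x, HasDerivAt f' (f'' x) x) (hf'' : Continuous f'') (h0 : f 0 = 0)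
    (hpi : f Real.pi = 0) (n : ℕ) :
    ∫ x in (0 : ℝ)..Real.pi, f'' x * sinMode n x =
      -((n : ℂ) + 1) ^ 2 * ∫ x in (0 : ℝ)..Real.pi, f x * sinMode n x := by
  have hf : Continuous f := continuous_iff_continuousAt.mpr fun x => (h1 x).continuousAt
  set c : ℂ := (n : ℂ) + 1 with hc
  have hcos : ∀ x : ℝ, HasDerivAt (fun x : ℝ => Complex.cos (c * x)) (-(c * sinMode n x)) x := by
    intro x
    have h := ((Complex.hasDerivAt_cos _).comp (x : ℂ)
      ((hasDerivAt_id (x : ℂ)).const_mul c)).comp_ofReal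
    refine h.congr_deriv ?_
    simp [sinMode, hc, mul_comm]
  have hd : ∀ x ∈ Set.uIcc 0 Real.pi, HasDerivAt
      (fun x : ℝ => f' x * sinMode n x - c * (f x * Complex.cos (c * x)))
      (f'' x * sinMode n x - (-c ^ 2 * (f x * sinMode n x))) x := by
    intro x _
    refine (((h2 x).mul (hasDerivAt_sinMode n x)).sub
      (((h1 x).mul (hcos x)).const_mul c)).congr_deriv ?_
    ring
  have h := intervalIntegral.integral_eq_sub_of_hasDerivAt hd
    (Continuous.intervalIntegrable (by fun_prop) _ _)
  rw [intervalIntegral.integral_sub, intervalIntegral.integral_const_mul, h0, hpi, sinMode_zero,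
    sinMode_pi] at h
  · simp only [zero_mul, mul_zero, sub_self] at h
    rw [sub_eq_zero] at h
    exact h
  all_goals exact Continuous.intervalIntegrable (by fun_prop) _ _

lemma sineCoeff_congr {g h : ℝ → ℝ → ℂ}
    (hgh : ∀ x ∈ Set.Icc 0 Real.pi, ∀ y ∈ Set.Icc 0 Real.pi, g x y = h x y) (i : ℕ × ℕ) :
    sineCoeff g i = sineCoeff h i := by
  unfold sineCoeff
  refine intervalIntegral.integral_congr fun y hy => ?_
  rw [Set.uIcc_of_le Real.pi_pos.le] at hy
  refine congrArg (· * sinMode i.2 y) ?_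
  refine intervalIntegral.integral_congr fun x hx => ?_
  rw [Set.uIcc_of_le Real.pi_pos.le] at hx
  simp only [hgh x hx y hy]

lemma sineCoeff_swap {g : ℝ → ℝ → ℂ} (hg : Continuous (Function.uncurry g)) (i : ℕ × ℕ) :
    sineCoeff g i = sineCoeff (fun x y => g y x) (i.2, i.1) := by
  unfold sineCoeff
  simp_rw [← intervalIntegral.integral_mul_const]
  rw [MeasureTheory.intervalIntegral_intervalIntegral_swap]
  · congr 1 with x
    congr 1 with y
    ring
  · have hg' : Continuous fun q : ℝ × ℝ => g q.1 q.2 := hg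
    have hc : Continuous (Function.uncurry fun y x => g x y * sinMode i.1 x * sinMode i.2 y) := by
      simp only [Function.uncurry_def]
      exact ((hg'.comp (by fun_prop : Continuous fun q : ℝ × ℝ => (q.2, q.1))).mul
        (by fun_prop)).mul (by fun_prop)
    exact (hc.continuousOn.integrableOn_compact (isCompact_uIcc.prod isCompact_uIcc)).mono_set
      (Set.prod_mono Set.uIoc_subset_uIcc Set.uIoc_subset_uIcc)

lemma sineCoeff_deriv_deriv_fst {g g' g'' : ℝ → ℝ → ℂ}
    (h1 : ∀ x y, HasDerivAt (fun s => g s y) (g' x y) x)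
    (h2 : ∀ x y, HasDerivAt (fun s => g' s y) (g'' x y) x)
    (hg'' : Continuous (Function.uncurry g''))
    (h0 : ∀ y ∈ Set.Icc 0 Real.pi, g 0 y = 0) (hpi : ∀ y ∈ Set.Icc 0 Real.pi, g Real.pi y = 0)
    (i : ℕ × ℕ) : sineCoeff g'' i = -((i.1 : ℂ) + 1) ^ 2 * sineCoeff g i := by
  unfold sineCoeff
  rw [← intervalIntegral.integral_const_mul]
  refine intervalIntegral.integral_congr fun y hy => ?_
  rw [Set.uIcc_of_le Real.pi_pos.le] at hy
  rw [integral_deriv_deriv_mul_sinMode (fun x => h1 x y) (fun x => h2 x y)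
    (hg''.comp (by fun_prop : Continuous fun x : ℝ => (x, y))) (h0 y hy) (hpi y hy), mul_assoc]

/-- The angular frequency of the eigenmode `sin((k+1)x) sin((j+1)y)`, indexed by `(k, j)`. -/
noncomputable def modeFreq (i : ℕ × ℕ) : ℝ :=
  Real.sqrt (((i.2 : ℝ) + 1) ^ 2 + ((i.1 : ℝ) + 1) ^ 2)

lemma modeFreq_sq (i : ℕ × ℕ) : modeFreq i ^ 2 = ((i.2 : ℝ) + 1) ^ 2 + ((i.1 : ℝ) + 1) ^ 2 :=
  Real.sq_sqrt (by positivity)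

lemma fst_add_one_le_modeFreq (i : ℕ × ℕ) : (i.1 : ℝ) + 1 ≤ modeFreq i :=
  Real.le_sqrt_of_sq_le (by nlinarith [sq_nonneg ((i.2 : ℝ) + 1)])

lemma snd_add_one_le_modeFreq (i : ℕ × ℕ) : (i.2 : ℝ) + 1 ≤ modeFreq i :=
  Real.le_sqrt_of_sq_le (by nlinarith [sq_nonneg ((i.1 : ℝ) + 1)])

lemma one_le_modeFreq (i : ℕ × ℕ) : 1 ≤ modeFreq i :=
  le_trans (by simp) (fst_add_one_le_modeFreq i)

lemma summable_modeFreq_pow_four_inv : Summable fun i => (modeFreq i ^ 4)⁻¹ := by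
  have h1 : Summable fun n : ℕ => (((n : ℝ) + 1) ^ 2)⁻¹ := by
    have := (summable_nat_add_iff 1).mpr (Real.summable_nat_pow_inv.mpr one_lt_two)
    simpa using this
  have h2 := h1.mul_of_nonneg h1 (fun n => by positivity) (fun n => by positivity)
  refine h2.of_nonneg_of_le (fun i => by have := one_le_modeFreq i; positivity) fun i => ?_
  rw [← mul_inv]
  refine inv_anti₀ (by positivity) ?_
  calc ((i.1 : ℝ) + 1) ^ 2 * ((i.2 : ℝ) + 1) ^ 2 ≤ modeFreq i ^ 2 * modeFreq i ^ 2 := by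
        gcongr
        · exact fst_add_one_le_modeFreq i
        · exact snd_add_one_le_modeFreq i
    _ = modeFreq i ^ 4 := by ring

lemma hasDerivAt_exp_mul_ofReal (c : ℂ) (t : ℝ) :
    HasDerivAt (fun t : ℝ => Complex.exp (c * t)) (Complex.exp (c * t) * c) t := by
  have h := ((Complex.hasDerivAt_exp _).comp (t : ℂ)
    ((hasDerivAt_id (t : ℂ)).const_mul c)).comp_ofReal
  refine h.congr_deriv ?_
  simp

/-- Solution formula for the linear equation of second order with constant coefficient `c²`. -/
lemma eq_exp_add_exp_of_deriv_deriv {a a' : ℝ → ℂ} {c : ℂ} (hc : c ≠ 0)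
    (h1 : ∀ t, HasDerivAt a (a' t) t) (h2 : ∀ t, HasDerivAt a' (c ^ 2 * a t) t) (t : ℝ) :
    a t = (a 0 + a' 0 / c) / 2 * Complex.exp (c * t) +
      (a 0 - a' 0 / c) / 2 * Complex.exp (-(c * t)) := by
  have key : ∀ d : ℂ, d ^ 2 = c ^ 2 → a' t + d * a t = (a' 0 + d * a 0) * Complex.exp (d * t) := by
    intro d hd
    have hD : ∀ s : ℝ, HasDerivAt (fun s : ℝ => (a' s + d * a s) * Complex.exp (-d * s)) 0 s := by
      intro s
      refine (((h2 s).add ((h1 s).const_mul d)).mul (hasDerivAt_exp_mul_ofReal (-d) s)).congr_deriv ?_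
      rw [← hd, Pi.add_apply]
      ring
    have hconst := is_const_of_deriv_eq_zero (fun s => (hD s).differentiableAt)
      (fun s => (hD s).deriv) t 0
    simp only [Complex.ofReal_zero, mul_zero, Complex.exp_zero, mul_one] at hconst
    rw [← hconst, mul_assoc, ← Complex.exp_add]
    simp
  have hp := key c rfl
  have hm := key (-c) (by ring)
  rw [neg_mul c (t : ℂ)] at hm
  field_simp
  linear_combination hp - hm

section WaveSolution

variable {u : ℝ × ℝ × ℝ → ℂ}

lemma sineCoeff_d1_d1 (hu : ContDiff ℝ (⊤ : ℕ∞) u)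
    (hwave : ∀ t x y : ℝ, 0 ≤ x → x ≤ Real.pi → 0 ≤ y → y ≤ Real.pi →
      d1 (d1 u) (t, x, y) = d2 (d2 u) (t, x, y) + d3 (d3 u) (t, x, y))
    (hbc : ∀ t x y : ℝ, 0 ≤ x → x ≤ Real.pi → 0 ≤ y → y ≤ Real.pi →
      (x = 0 ∨ x = Real.pi ∨ y = 0 ∨ y = Real.pi) → u (t, x, y) = 0) (i : ℕ × ℕ) (t : ℝ) :
    sineCoeff (fun x y => d1 (d1 u) (t, x, y)) i =
      -(modeFreq i : ℂ) ^ 2 * sineCoeff (fun x y => u (t, x, y)) i := by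
  have hpi := Real.pi_pos.le
  have hc := continuous_slice hu.continuous t
  have hc2 := continuous_slice (contDiff_d2 (contDiff_d2 hu)).continuous t
  have hc3 := continuous_slice (contDiff_d3 (contDiff_d3 hu)).continuous t
  have hx := sineCoeff_deriv_deriv_fst (fun x y => hasDerivAt_d2 hu t x y)
    (fun x y => hasDerivAt_d2 (contDiff_d2 hu) t x y) hc2
    (fun y hy => hbc t 0 y le_rfl hpi hy.1 hy.2 (by simp))
    (fun y hy => hbc t Real.pi y hpi le_rfl hy.1 hy.2 (by simp)) i
  have hy := sineCoeff_deriv_deriv_fst (fun y x => hasDerivAt_d3 hu t x y)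
    (fun y x => hasDerivAt_d3 (contDiff_d3 hu) t x y)
    (hc3.comp (by fun_prop : Continuous fun q : ℝ × ℝ => (q.2, q.1)))
    (fun x hx => hbc t x 0 hx.1 hx.2 le_rfl hpi (by simp))
    (fun x hx => hbc t x Real.pi hx.1 hx.2 hpi le_rfl (by simp)) (i.2, i.1)
  rw [← sineCoeff_swap hc3, ← sineCoeff_swap hc] at hy
  have hsum : sineCoeff (fun x y => d1 (d1 u) (t, x, y)) i =
      sineCoeff (fun x y => d2 (d2 u) (t, x, y)) i +
        sineCoeff (fun x y => d3 (d3 u) (t, x, y)) i := by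
    rw [eq_comm, ← eq_sub_iff_add_eq, ← sineCoeff_sub
      (continuous_slice (contDiff_d1 (contDiff_d1 hu)).continuous t) hc3]
    refine sineCoeff_congr (fun x hx y hy => ?_) i
    rw [hwave t x y hx.1 hx.2 hy.1 hy.2]
    ring
  have hfreq : (modeFreq i : ℂ) ^ 2 = ((i.2 : ℂ) + 1) ^ 2 + ((i.1 : ℂ) + 1) ^ 2 := by
    exact_mod_cast congrArg (fun r : ℝ => (r : ℂ)) (modeFreq_sq i)
  rw [hsum, hx, hy, hfreq]
  ring

lemma sineCoeff_iterate_d1_add_two (hu : ContDiff ℝ (⊤ : ℕ∞) u) {i : ℕ × ℕ} {c : ℂ}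
    (hode : ∀ t, sineCoeff (fun x y => d1 (d1 u) (t, x, y)) i =
      c * sineCoeff (fun x y => u (t, x, y)) i) (n : ℕ) (t : ℝ) :
    sineCoeff (fun x y => (d1^[n + 2] u) (t, x, y)) i =
      c * sineCoeff (fun x y => (d1^[n] u) (t, x, y)) i := by
  induction n generalizing t with
  | zero => exact hode t
  | succ n ih =>
    have h1 := hasDerivAt_sineCoeff (contDiff_iterate_d1 hu (n + 2)) i t
    have h2 := (hasDerivAt_sineCoeff (contDiff_iterate_d1 hu n) i t).const_mul c
    rw [← Function.iterate_succ_apply' d1] at h1 h2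
    exact h1.unique (h2.congr_of_eventuallyEq (Filter.Eventually.of_forall ih))

lemma sineCoeff_iterate_d1_add_two_mul (hu : ContDiff ℝ (⊤ : ℕ∞) u) {i : ℕ × ℕ} {c : ℂ}
    (hode : ∀ t, sineCoeff (fun x y => d1 (d1 u) (t, x, y)) i =
      c * sineCoeff (fun x y => u (t, x, y)) i) (n N : ℕ) (t : ℝ) :
    sineCoeff (fun x y => (d1^[n + 2 * N] u) (t, x, y)) i =
      c ^ N * sineCoeff (fun x y => (d1^[n] u) (t, x, y)) i := by
  induction N with
  | zero => simp
  | succ N ih =>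
    rw [show n + 2 * (N + 1) = (n + 2 * N) + 2 by ring, sineCoeff_iterate_d1_add_two hu hode, ih]
    ring

/-- Rapid decay of the sine coefficients at time zero of all time derivatives of a solution. -/
lemma exists_modeFreq_pow_mul_norm_sineCoeff_le (hu : ContDiff ℝ (⊤ : ℕ∞) u)
    (hode : ∀ i t, sineCoeff (fun x y => d1 (d1 u) (t, x, y)) i =
      -(modeFreq i : ℂ) ^ 2 * sineCoeff (fun x y => u (t, x, y)) i) (n N : ℕ) :
    ∃ C, ∀ i, modeFreq i ^ N * ‖sineCoeff (fun x y => (d1^[n] u) (0, x, y)) i‖ ≤ C := by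
  have hv := (contDiff_iterate_d1 hu (n + 2 * N)).continuous
  obtain ⟨M, hM⟩ := (isCompact_Icc.prod isCompact_Icc :
    IsCompact (Set.Icc 0 Real.pi ×ˢ Set.Icc 0 Real.pi)).exists_bound_of_continuousOn
    (continuous_slice hv 0).continuousOn
  have hM0 : 0 ≤ M :=
    (norm_nonneg _).trans (hM (0, 0) ⟨⟨le_rfl, Real.pi_pos.le⟩, ⟨le_rfl, Real.pi_pos.le⟩⟩)
  refine ⟨M * Real.pi * Real.pi, fun i => ?_⟩
  have hω := one_le_modeFreq i
  have h := norm_sineCoeff_le hM0 (fun x hx y hy => hM (x, y) ⟨hx, hy⟩) i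
  refine le_trans ?_ h
  have heq := sineCoeff_iterate_d1_add_two_mul hu (hode i) n N 0
  simp only [Function.uncurry_apply_pair]
  rw [heq, norm_mul, norm_pow, norm_neg, norm_pow, Complex.norm_real, Real.norm_eq_abs,
    abs_of_pos (by linarith), ← pow_mul]
  gcongr
  omega

end WaveSolution

lemma norm_iteratedFDeriv_mul_le_pow {E : Type*} [NormedAddCommGroup E] [NormedSpace ℝ E]
    {f g : E → ℂ} (hf : ContDiff ℝ (⊤ : ℕ∞) f) (hg : ContDiff ℝ (⊤ : ℕ∞) g) {A B : ℝ}
    (hA : 0 ≤ A) (hfA : ∀ (l : ℕ) x, ‖iteratedFDeriv ℝ l f x‖ ≤ A ^ l)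
    (hgB : ∀ (l : ℕ) x, ‖iteratedFDeriv ℝ l g x‖ ≤ B ^ l) (l : ℕ) (x : E) :
    ‖iteratedFDeriv ℝ l (fun y => f y * g y) x‖ ≤ (A + B) ^ l := by
  refine (norm_iteratedFDeriv_mul_le hf hg x (n := l)
    (by exact_mod_cast (le_top : (l : ℕ∞) ≤ ⊤))).trans ?_
  rw [add_pow]
  refine Finset.sum_le_sum fun k _ => ?_
  calc (l.choose k : ℝ) * ‖iteratedFDeriv ℝ k f x‖ * ‖iteratedFDeriv ℝ (l - k) g x‖
      ≤ l.choose k * A ^ k * B ^ (l - k) := by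
        gcongr
        · exact hfA k x
        · exact hgB (l - k) x
    _ = A ^ k * B ^ (l - k) * l.choose k := by ring

lemma norm_iteratedFDeriv_comp_clm_le_s7 {E : Type*} [NormedAddCommGroup E] [NormedSpace ℝ E]
    {f : ℝ → ℂ} (hf : ContDiff ℝ (⊤ : ℕ∞) f) (L : E →L[ℝ] ℝ) (hL : ‖L‖ ≤ 1) (l : ℕ) (x : E) :
    ‖iteratedFDeriv ℝ l (fun y => f (L y)) x‖ ≤ ‖iteratedDeriv l f (L x)‖ := by
  have h := L.iteratedFDeriv_comp_right hf x (i := l)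
    (by exact_mod_cast (le_top : (l : ℕ∞) ≤ ⊤))
  have h' : (fun y => f (L y)) = f ∘ L := rfl
  rw [h', h, ← norm_iteratedFDeriv_eq_norm_iteratedDeriv]
  refine (ContinuousMultilinearMap.norm_compContinuousLinearMap_le _ _).trans ?_
  refine mul_le_of_le_one_right (norm_nonneg _) ?_
  exact Finset.prod_le_one (fun _ _ => norm_nonneg _) fun _ _ => hL

lemma iteratedDeriv_exp_add_exp (α β c : ℂ) (l : ℕ) :
    iteratedDeriv l (fun x : ℝ => α * Complex.exp (c * x) + β * Complex.exp (-c * x)) =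
      fun x : ℝ => α * c ^ l * Complex.exp (c * x) + β * (-c) ^ l * Complex.exp (-c * x) := by
  induction l with
  | zero => simp
  | succ l ih =>
    rw [iteratedDeriv_succ, ih]
    ext x
    refine ((((hasDerivAt_exp_mul_ofReal c x).const_mul (α * c ^ l)).add
      ((hasDerivAt_exp_mul_ofReal (-c) x).const_mul (β * (-c) ^ l)))).deriv.trans ?_
    ring

lemma norm_iteratedDeriv_exp_add_exp_le (α β : ℂ) (r : ℝ) (l : ℕ) (x : ℝ) :
    ‖iteratedDeriv l (fun x : ℝ => α * Complex.exp (r * Complex.I * x) +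
      β * Complex.exp (-(r * Complex.I) * x)) x‖ ≤ (‖α‖ + ‖β‖) * |r| ^ l := by
  rw [iteratedDeriv_exp_add_exp]
  have h : ∀ s : ℝ, ‖Complex.exp (s * Complex.I * x)‖ = 1 := by
    intro s
    rw [show (s : ℂ) * Complex.I * x = ((s * x : ℝ) : ℂ) * Complex.I by push_cast; ring]
    exact Complex.norm_exp_ofReal_mul_I _
  have h2 := h (-r)
  rw [Complex.ofReal_neg, neg_mul] at h2
  refine (norm_add_le _ _).trans_eq ?_
  simp only [norm_mul, norm_pow, norm_neg, h, h2, Complex.norm_real, Complex.norm_I,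
    Real.norm_eq_abs]
  ring

lemma norm_iteratedDeriv_sinMode_le (n l : ℕ) (x : ℝ) :
    ‖iteratedDeriv l (sinMode n) x‖ ≤ ((n : ℝ) + 1) ^ l := by
  have h := norm_iteratedDeriv_exp_add_exp_le (-Complex.I / 2) (Complex.I / 2) ((n : ℝ) + 1) l x
  have heq : sinMode n = fun x : ℝ =>
      -Complex.I / 2 * Complex.exp ((((n : ℝ) + 1 : ℝ) : ℂ) * Complex.I * x) +
      Complex.I / 2 * Complex.exp (-((((n : ℝ) + 1 : ℝ) : ℂ) * Complex.I) * x) := by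
    ext x
    rw [sinMode, Complex.sin]
    push_cast
    ring_nf
  rw [heq]
  refine h.trans_eq ?_
  rw [abs_of_nonneg (by positivity)]
  simp only [norm_div, norm_neg, Complex.norm_I, Complex.norm_ofNat]
  ring

lemma contDiff_sinMode (n : ℕ) : ContDiff ℝ (⊤ : ℕ∞) (sinMode n) := by
  have h : ContDiff ℝ (⊤ : ℕ∞) fun x : ℝ => ((n : ℂ) + 1) * (x : ℂ) :=
    contDiff_const.mul Complex.ofRealCLM.contDiff
  exact (Complex.contDiff_sin.restrict_scalars ℝ).comp h

/-- The separated solution with time factor `exp(s i ω t)`. -/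
noncomputable def waveMode (i : ℕ × ℕ) (s : ℝ) : ℝ × ℝ × ℝ → ℂ :=
  squareBasis ((i.2 : ℤ) + 1) ((i.1 : ℤ) + 1) s

lemma waveMode_apply (i : ℕ × ℕ) (s : ℝ) (p : ℝ × ℝ × ℝ) :
    waveMode i s p = Complex.exp ((s * modeFreq i : ℝ) * Complex.I * p.1) *
      (sinMode i.1 p.2.1 * sinMode i.2 p.2.2) := by
  simp only [waveMode, squareBasis, sinMode, modeFreq]
  push_cast
  rw [mul_assoc]
  congr 2
  ring

lemma contDiff_exp_mul_ofReal (c : ℂ) :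
    ContDiff ℝ (⊤ : ℕ∞) fun t : ℝ => Complex.exp (c * t) :=
  Complex.contDiff_exp.comp (contDiff_const.mul Complex.ofRealCLM.contDiff)

lemma contDiff_waveMode (i : ℕ × ℕ) (s : ℝ) : ContDiff ℝ (⊤ : ℕ∞) (waveMode i s) := by
  rw [funext (waveMode_apply i s)]
  exact ((contDiff_exp_mul_ofReal _).comp contDiff_fst).mul
    (((contDiff_sinMode _).comp (contDiff_fst.comp contDiff_snd)).mul
      ((contDiff_sinMode _).comp (contDiff_snd.comp contDiff_snd)))

lemma norm_iteratedFDeriv_waveMode_le (i : ℕ × ℕ) {s : ℝ} (hs : |s| = 1) (l : ℕ)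
    (p : ℝ × ℝ × ℝ) : ‖iteratedFDeriv ℝ l (waveMode i s) p‖ ≤ (3 * modeFreq i) ^ l := by
  have hω := one_le_modeFreq i
  have hω0 : 0 ≤ modeFreq i := by linarith
  set L₁ : ℝ × ℝ × ℝ →L[ℝ] ℝ := ContinuousLinearMap.fst ℝ ℝ (ℝ × ℝ)
  set L : ℝ × ℝ × ℝ →L[ℝ] ℝ × ℝ := ContinuousLinearMap.snd ℝ ℝ (ℝ × ℝ)
  set L₂ : ℝ × ℝ × ℝ →L[ℝ] ℝ := (ContinuousLinearMap.fst ℝ ℝ ℝ).comp L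
  set L₃ : ℝ × ℝ × ℝ →L[ℝ] ℝ := (ContinuousLinearMap.snd ℝ ℝ ℝ).comp L
  have hL : ‖L‖ ≤ 1 := ContinuousLinearMap.norm_snd_le ..
  have hL₂ : ‖L₂‖ ≤ 1 := (ContinuousLinearMap.opNorm_comp_le _ _).trans
    (mul_le_one₀ (ContinuousLinearMap.norm_fst_le ..) (norm_nonneg _) hL)
  have hL₃ : ‖L₃‖ ≤ 1 := (ContinuousLinearMap.opNorm_comp_le _ _).trans
    (mul_le_one₀ (ContinuousLinearMap.norm_snd_le ..) (norm_nonneg _) hL)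
  set e : ℝ → ℂ := fun t => Complex.exp ((s * modeFreq i : ℝ) * Complex.I * t)
  have he : ContDiff ℝ (⊤ : ℕ∞) e := contDiff_exp_mul_ofReal _
  have hex : ∀ (l : ℕ) (t : ℝ), ‖iteratedDeriv l e t‖ ≤ modeFreq i ^ l := by
    intro l t
    have h := norm_iteratedDeriv_exp_add_exp_le 1 0 (s * modeFreq i) l t
    simp only [one_mul, zero_mul, add_zero, norm_one, norm_zero, abs_mul, hs,
      abs_of_nonneg hω0] at h
    exact h
  have h1 : ∀ (l : ℕ) (p : ℝ × ℝ × ℝ), ‖iteratedFDeriv ℝ l (fun p => e (L₁ p)) p‖ ≤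
      modeFreq i ^ l := fun l p =>
    (norm_iteratedFDeriv_comp_clm_le_s7 he L₁ (ContinuousLinearMap.norm_fst_le ..) l p).trans (hex _ _)
  have h2 : ∀ (l : ℕ) (p : ℝ × ℝ × ℝ), ‖iteratedFDeriv ℝ l (fun p => sinMode i.1 (L₂ p)) p‖ ≤
      modeFreq i ^ l := fun l p =>
    (norm_iteratedFDeriv_comp_clm_le_s7 (contDiff_sinMode _) L₂ hL₂ l p).trans
      ((norm_iteratedDeriv_sinMode_le _ _ _).trans
        (pow_le_pow_left₀ (by positivity) (fst_add_one_le_modeFreq i) l))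
  have h3 : ∀ (l : ℕ) (p : ℝ × ℝ × ℝ), ‖iteratedFDeriv ℝ l (fun p => sinMode i.2 (L₃ p)) p‖ ≤
      modeFreq i ^ l := fun l p =>
    (norm_iteratedFDeriv_comp_clm_le_s7 (contDiff_sinMode _) L₃ hL₃ l p).trans
      ((norm_iteratedDeriv_sinMode_le _ _ _).trans
        (pow_le_pow_left₀ (by positivity) (snd_add_one_le_modeFreq i) l))
  have c1 := he.comp L₁.contDiff
  have c2 := (contDiff_sinMode i.1).comp L₂.contDiff
  have c3 := (contDiff_sinMode i.2).comp L₃.contDiff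
  have h := norm_iteratedFDeriv_mul_le_pow c1 (c2.mul c3) hω0 h1
    (norm_iteratedFDeriv_mul_le_pow c2 c3 hω0 h2 h3) l p
  rw [funext (waveMode_apply i s)]
  refine h.trans_eq ?_
  ring

/-- A solution of the Dirichlet problem is the sum of a series of separated solutions with rapidly
decaying coefficients. -/
lemma exists_eq_tsum_waveMode {u : ℝ × ℝ × ℝ → ℂ} (hu : ContDiff ℝ (⊤ : ℕ∞) u)
    (hwave : ∀ t x y : ℝ, 0 ≤ x → x ≤ Real.pi → 0 ≤ y → y ≤ Real.pi →
      d1 (d1 u) (t, x, y) = d2 (d2 u) (t, x, y) + d3 (d3 u) (t, x, y))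
    (hbc : ∀ t x y : ℝ, 0 ≤ x → x ≤ Real.pi → 0 ≤ y → y ≤ Real.pi →
      (x = 0 ∨ x = Real.pi ∨ y = 0 ∨ y = Real.pi) → u (t, x, y) = 0) :
    ∃ cp cm : ℕ × ℕ → ℂ,
      (∀ N : ℕ, ∃ C, ∀ i, modeFreq i ^ N * (‖cp i‖ + ‖cm i‖) ≤ C) ∧
      ∀ t, ∀ x ∈ Set.Icc 0 Real.pi, ∀ y ∈ Set.Icc 0 Real.pi,
        u (t, x, y) =
          ∑' i, (cp i * waveMode i 1 (t, x, y) + cm i * waveMode i (-1) (t, x, y)) := by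
  have hode := sineCoeff_d1_d1 hu hwave hbc
  set a₀ : ℕ × ℕ → ℂ := fun i => sineCoeff (fun x y => u (0, x, y)) i with ha₀
  set a₁ : ℕ × ℕ → ℂ := fun i => sineCoeff (fun x y => d1 u (0, x, y)) i with ha₁
  have hω := one_le_modeFreq
  have hω0 : ∀ i, (modeFreq i : ℂ) ≠ 0 := fun i => by
    have := hω i
    exact_mod_cast (by linarith : modeFreq i ≠ 0)
  have hpi : (Real.pi : ℂ) ≠ 0 := by exact_mod_cast Real.pi_ne_zero
  set q : ℂ := ((Real.pi : ℂ) / 2) ^ 2 with hq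
  have hq0 : q ≠ 0 := pow_ne_zero _ (div_ne_zero hpi two_ne_zero)
  set cp : ℕ × ℕ → ℂ := fun i => q⁻¹ * ((a₀ i + a₁ i / (modeFreq i * Complex.I)) / 2) with hcp
  set cm : ℕ × ℕ → ℂ := fun i => q⁻¹ * ((a₀ i - a₁ i / (modeFreq i * Complex.I)) / 2) with hcm
  have hdecay : ∀ N : ℕ, ∃ C, ∀ i, modeFreq i ^ N * (‖cp i‖ + ‖cm i‖) ≤ C := by
    intro N
    obtain ⟨C₀, hC₀⟩ := exists_modeFreq_pow_mul_norm_sineCoeff_le hu hode 0 N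
    obtain ⟨C₁, hC₁⟩ := exists_modeFreq_pow_mul_norm_sineCoeff_le hu hode 1 N
    refine ⟨‖q⁻¹‖ * (C₀ + C₁), fun i => ?_⟩
    have h0 : modeFreq i ^ N * ‖a₀ i‖ ≤ C₀ := hC₀ i
    have h1 : modeFreq i ^ N * ‖a₁ i‖ ≤ C₁ := hC₁ i
    have hdiv : ‖a₁ i / (modeFreq i * Complex.I)‖ ≤ ‖a₁ i‖ := by
      rw [norm_div, norm_mul, Complex.norm_I, mul_one, Complex.norm_real, Real.norm_eq_abs]
      exact div_le_self (norm_nonneg _) ((hω i).trans (le_abs_self _))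
    have hp : ‖cp i‖ ≤ ‖q⁻¹‖ * ((‖a₀ i‖ + ‖a₁ i‖) / 2) := by
      rw [hcp, norm_mul, norm_div, Complex.norm_ofNat]
      gcongr
      exact (norm_add_le _ _).trans (by gcongr)
    have hm : ‖cm i‖ ≤ ‖q⁻¹‖ * ((‖a₀ i‖ + ‖a₁ i‖) / 2) := by
      rw [hcm, norm_mul, norm_div, Complex.norm_ofNat]
      gcongr
      exact (norm_sub_le _ _).trans (by gcongr)
    have hpow : 0 ≤ modeFreq i ^ N := by
      have := hω i
      positivity
    calc modeFreq i ^ N * (‖cp i‖ + ‖cm i‖)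
        ≤ modeFreq i ^ N * (‖q⁻¹‖ * (‖a₀ i‖ + ‖a₁ i‖)) :=
          mul_le_mul_of_nonneg_left (by linarith) hpow
      _ = ‖q⁻¹‖ * (modeFreq i ^ N * ‖a₀ i‖ + modeFreq i ^ N * ‖a₁ i‖) := by ring
      _ ≤ ‖q⁻¹‖ * (C₀ + C₁) := by gcongr
  refine ⟨cp, cm, hdecay, fun t x hx y hy => ?_⟩
  set b : ℕ × ℕ → ℂ := fun i => cp i * Complex.exp (modeFreq i * Complex.I * t) +
    cm i * Complex.exp (-(modeFreq i * Complex.I * t)) with hb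
  have hexp : ∀ i (s : ℝ), ‖Complex.exp (s * modeFreq i * Complex.I * t)‖ = 1 := by
    intro i s
    rw [show (s : ℂ) * modeFreq i * Complex.I * t = ((s * modeFreq i * t : ℝ) : ℂ) * Complex.I by
      push_cast; ring]
    exact Complex.norm_exp_ofReal_mul_I _
  have hbs : Summable fun i => ‖b i‖ := by
    obtain ⟨C, hC⟩ := hdecay 4
    refine (summable_modeFreq_pow_four_inv.mul_left C).of_nonneg_of_le (fun _ => norm_nonneg _)
      fun i => ?_
    have h1 := hexp i 1
    have h2 := hexp i (-1)
    simp only [Complex.ofReal_one, one_mul, Complex.ofReal_neg, neg_mul] at h1 h2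
    have hpos : 0 < modeFreq i ^ 4 := by
      have := hω i
      positivity
    have hbi : ‖b i‖ ≤ ‖cp i‖ + ‖cm i‖ := by
      refine (norm_add_le _ _).trans_eq ?_
      rw [norm_mul (cp i), norm_mul (cm i), h1, h2, mul_one, mul_one]
    rw [← div_eq_mul_inv, le_div_iff₀ hpos, mul_comm]
    exact (mul_le_mul_of_nonneg_left hbi hpos.le).trans (hC i)
  have hcoeff : ∀ i, sineCoeff (fun x y => u (t, x, y)) i = b i * q := by
    intro i
    have hsol := eq_exp_add_exp_of_deriv_deriv
      (a := fun t => sineCoeff (fun x y => u (t, x, y)) i)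
      (a' := fun t => sineCoeff (fun x y => d1 u (t, x, y)) i)
      (mul_ne_zero (hω0 i) Complex.I_ne_zero) (hasDerivAt_sineCoeff hu i)
      (fun t => by
        refine (hasDerivAt_sineCoeff (contDiff_d1 hu) i t).congr_deriv ?_
        rw [hode, mul_pow, Complex.I_sq]
        ring) t
    refine hsol.trans ?_
    simp only [hb, hcp, hcm, ha₀, ha₁]
    field_simp
  rw [eq_tsum_of_sineCoeff (continuous_slice hu.continuous t) hbs hcoeff hx hy]
  congr 1 with i
  rw [waveMode_apply, waveMode_apply]
  simp only [hb, one_mul, neg_mul, Complex.ofReal_neg]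
  ring

lemma iteratedFDeriv_eqOn_strip {u v : ℝ × ℝ × ℝ → ℂ} (hu : ContDiff ℝ (⊤ : ℕ∞) u)
    (hv : ContDiff ℝ (⊤ : ℕ∞) v)
    (h : Set.EqOn u v (Set.univ ×ˢ Set.Icc 0 Real.pi ×ˢ Set.Icc 0 Real.pi)) (l : ℕ) :
    Set.EqOn (iteratedFDeriv ℝ l u) (iteratedFDeriv ℝ l v)
      (Set.univ ×ˢ Set.Icc 0 Real.pi ×ˢ Set.Icc 0 Real.pi) := by
  set U : Set (ℝ × ℝ × ℝ) := Set.univ ×ˢ Set.Ioo 0 Real.pi ×ˢ Set.Ioo 0 Real.pi with hU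
  have hUo : IsOpen U := isOpen_univ.prod (isOpen_Ioo.prod isOpen_Ioo)
  have hUc : closure U = Set.univ ×ˢ Set.Icc 0 Real.pi ×ˢ Set.Icc 0 Real.pi := by
    rw [hU, closure_prod_eq, closure_prod_eq, closure_univ, closure_Ioo Real.pi_pos.ne]
  have hl : ((l : ℕ∞) : WithTop ℕ∞) ≤ ((⊤ : ℕ∞) : WithTop ℕ∞) := by exact_mod_cast le_top
  rw [← hUc]
  refine Set.EqOn.closure (fun p hp => ?_) (hu.continuous_iteratedFDeriv hl)
    (hv.continuous_iteratedFDeriv hl)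
  refine Filter.EventuallyEq.eq_of_nhds (Filter.EventuallyEq.iteratedFDeriv ℝ ?_ l)
  filter_upwards [hUo.mem_nhds hp] with z hz
  exact h (hUc ▸ subset_closure hz)

/-- The family `{exp(±i√(j²+k²) t) sin(kx) sin(jy)}` has dense span in the smooth solutions of
the 2D wave equation on the square `[0,π]²` with Dirichlet conditions on all four sides. -/
theorem bepgp_wave2D_square_dirichlet_dense
    (u : ℝ × ℝ × ℝ → ℂ) (hu : ContDiff ℝ (⊤ : ℕ∞) u)
    (hwave : ∀ t x y : ℝ, 0 ≤ x → x ≤ Real.pi → 0 ≤ y → y ≤ Real.pi →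
      d1 (d1 u) (t, x, y) = d2 (d2 u) (t, x, y) + d3 (d3 u) (t, x, y))
    (hbc : ∀ t x y : ℝ, 0 ≤ x → x ≤ Real.pi → 0 ≤ y → y ≤ Real.pi →
      (x = 0 ∨ x = Real.pi ∨ y = 0 ∨ y = Real.pi) → u (t, x, y) = 0)
    (K : Set (ℝ × ℝ × ℝ)) (hKc : IsCompact K)
    (hK : K ⊆ Set.univ ×ˢ Set.Icc 0 Real.pi ×ˢ Set.Icc 0 Real.pi)
    (m : ℕ) (ε : ℝ) (hε : 0 < ε) :
    ∃ (r : ℕ) (j k : Fin r → ℤ) (s : Fin r → ℝ) (c : Fin r → ℂ),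
      (∀ h, s h = 1 ∨ s h = -1) ∧
      ∀ l ≤ m, ∀ p ∈ K,
        ‖iteratedFDeriv ℝ l
            (fun q => u q - ∑ h, c h * squareBasis (j h) (k h) (s h) q) p‖ ≤ ε := by
  obtain ⟨cp, cm, hdecay, hsum⟩ := exists_eq_tsum_waveMode hu hwave hbc
  set F : ℕ × ℕ → ℝ × ℝ × ℝ → ℂ := fun i p =>
    cp i * waveMode i 1 p + cm i * waveMode i (-1) p with hF
  set B : ℕ → ℕ × ℕ → ℝ := fun l i => (3 * modeFreq i) ^ l * (‖cp i‖ + ‖cm i‖) with hB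
  have hl : ∀ l : ℕ, ((l : ℕ∞) : WithTop ℕ∞) ≤ ((⊤ : ℕ∞) : WithTop ℕ∞) := fun l => by
    exact_mod_cast le_top
  have hFd : ∀ i, ContDiff ℝ (⊤ : ℕ∞) (F i) := fun i =>
    (contDiff_const.mul (contDiff_waveMode i 1)).add (contDiff_const.mul (contDiff_waveMode i _))
  have hFB : ∀ (l : ℕ) i p, ‖iteratedFDeriv ℝ l (F i) p‖ ≤ B l i := by
    intro l i p
    have h1 := ((contDiff_waveMode i 1).of_le (hl l)).contDiffAt (x := p)
    have h2 := ((contDiff_waveMode i (-1)).of_le (hl l)).contDiffAt (x := p)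
    have hadd : iteratedFDeriv ℝ l (F i) p = cp i • iteratedFDeriv ℝ l (waveMode i 1) p +
        cm i • iteratedFDeriv ℝ l (waveMode i (-1)) p := by
      rw [← iteratedFDeriv_const_smul_apply h1, ← iteratedFDeriv_const_smul_apply h2]
      exact iteratedFDeriv_add_apply (f := cp i • waveMode i 1) (g := cm i • waveMode i (-1))
        (h1.const_smul (cp i)) (h2.const_smul (cm i))
    rw [hadd]
    refine (norm_add_le _ _).trans ?_
    rw [norm_smul, norm_smul]
    have b1 := norm_iteratedFDeriv_waveMode_le i (s := 1) (by simp) l p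
    have b2 := norm_iteratedFDeriv_waveMode_le i (s := -1) (by simp) l p
    calc _ ≤ ‖cp i‖ * (3 * modeFreq i) ^ l + ‖cm i‖ * (3 * modeFreq i) ^ l := by gcongr
      _ = B l i := by rw [hB]; ring
  have hBs : ∀ l : ℕ, Summable (B l) := by
    intro l
    obtain ⟨C, hC⟩ := hdecay (l + 4)
    have hω := one_le_modeFreq
    refine (summable_modeFreq_pow_four_inv.mul_left (3 ^ l * C)).of_nonneg_of_le
      (fun i => by have := hω i; positivity) fun i => ?_
    have hpos : 0 < modeFreq i ^ 4 := by
      have := hω i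
      positivity
    rw [← div_eq_mul_inv, le_div_iff₀ hpos]
    calc B l i * modeFreq i ^ 4 = 3 ^ l * (modeFreq i ^ (l + 4) * (‖cp i‖ + ‖cm i‖)) := by
          rw [hB]; ring
      _ ≤ 3 ^ l * C := by gcongr; exact hC i
  have hv : ContDiff ℝ (⊤ : ℕ∞) fun p => ∑' i, F i p :=
    contDiff_tsum hFd (fun l _ => hBs l) fun l i p _ => hFB l i p
  have heq := iteratedFDeriv_eqOn_strip hu hv fun p hp =>
    hsum p.1 p.2.1 hp.2.1 p.2.2 hp.2.2
  have hunif : ∀ l ∈ Set.Iic m, ∀ᶠ s : Finset (ℕ × ℕ) in Filter.atTop, ∀ p,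
      dist (∑' i, iteratedFDeriv ℝ l (F i) p) (∑ i ∈ s, iteratedFDeriv ℝ l (F i) p) < ε :=
    fun l _ => Metric.tendstoUniformly_iff.mp (tendstoUniformly_tsum (hBs l) (hFB l)) ε hε
  obtain ⟨s, hs⟩ := ((Filter.eventually_all_finite (Set.finite_Iic m)).mpr hunif).exists
  set T : Finset ((ℕ × ℕ) × Bool) := s ×ˢ Finset.univ with hT
  set σ : Bool → ℝ := fun b => if b then 1 else -1 with hσ
  set idx : Fin T.card → (ℕ × ℕ) × Bool := fun h => (T.equivFin.symm h).1 with hidx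
  refine ⟨T.card, fun h => ((idx h).1.2 : ℤ) + 1, fun h => ((idx h).1.1 : ℤ) + 1,
    fun h => σ (idx h).2, fun h => if (idx h).2 then cp (idx h).1 else cm (idx h).1,
    fun h => by cases hb : (idx h).2 <;> simp [hσ, hb], fun l hlm p hp => ?_⟩
  have hsumF : ∀ q, ∑ h, (if (idx h).2 then cp (idx h).1 else cm (idx h).1) *
      squareBasis (((idx h).1.2 : ℤ) + 1) (((idx h).1.1 : ℤ) + 1) (σ (idx h).2) q =
      ∑ i ∈ s, F i q := by
    intro q
    set G : (ℕ × ℕ) × Bool → ℂ := fun a =>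
      (if a.2 then cp a.1 else cm a.1) * waveMode a.1 (σ a.2) q with hG
    calc _ = ∑ h, G (T.equivFin.symm h).1 := rfl
      _ = ∑ a : T, G a.1 := Equiv.sum_comp T.equivFin.symm fun a => G a.1
      _ = ∑ a ∈ T, G a := Finset.sum_coe_sort T G
      _ = ∑ i ∈ s, F i q := by
        rw [hT, Finset.sum_product]
        simp [hG, hF, hσ]
  simp_rw [hsumF]
  have hsub : iteratedFDeriv ℝ l (fun q => u q - ∑ i ∈ s, F i q) p =
      ∑' i, iteratedFDeriv ℝ l (F i) p - ∑ i ∈ s, iteratedFDeriv ℝ l (F i) p := by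
    have hFs : ContDiff ℝ (⊤ : ℕ∞) fun q => ∑ i ∈ s, F i q := ContDiff.sum fun i _ => hFd i
    rw [← iteratedFDeriv_tsum_apply hFd (fun l _ => hBs l) (fun l i p _ => hFB l i p) le_top p,
      ← heq l (hK hp), ← iteratedFDeriv_fun_sum_apply fun i _ => (hFd i).of_le (hl l) |>.contDiffAt]
    exact iteratedFDeriv_sub_apply (hu.of_le (hl l)).contDiffAt (hFs.of_le (hl l)).contDiffAt
  rw [hsub, ← dist_eq_norm]
  exact (hs l hlm p).le
end
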